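/- arXiv:2209.04894 — 3 statements merged into one kernel-verified Lean document; each statement's English description precedes it below -/
import Mathlib

section
/- Let k ≥ 4 be an integer and set θ = 1 + 1/√2 (so θ > log₂ 3). For every ε > 0 there exists n₀ such that every T_k-free partially directed k-graph H on n ≥ n₀ vertices satisfies e_u(H) + θ·e_d(H) ≤ (1+ε)·C(n,k), where C(n,k) is the binomial coefficient 'n choose k'. (In other words, π(T_k, 1 + 1/√2) = 1 for all k ≥ 4.) -/
section Defs

variable {V W : Type*}

/-- A clause is a finite set of literals; a literal is a variable paired with a polarity
(`true` = positive, `false` = negative). -/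
abbrev SatClause (V : Type*) := Finset (V × Bool)

/-- A formula is a finite set of clauses. -/
abbrev SatFormula (V : Type*) := Finset (SatClause V)

/-- The set of variables used by a clause. -/
def clauseVars [DecidableEq V] (C : SatClause V) : Finset V := C.image Prod.fst

/-- A valid `k`-SAT clause: `k` literals on `k` distinct variables. -/
def IsKClause [DecidableEq V] (k : ℕ) (C : SatClause V) : Prop :=
  C.card = k ∧ (clauseVars C).card = k

/-- A valid `k`-SAT formula. -/
def IsKFormula [DecidableEq V] (k : ℕ) (G : SatFormula V) : Prop :=
  ∀ C ∈ G, IsKClause k C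

/-- An assignment satisfies a clause if it makes all of its literals true. -/
def SatisfiesClause (a : V → Bool) (C : SatClause V) : Prop := ∀ l ∈ C, a l.1 = l.2

/-- A formula is minimal if every clause has a witness assignment satisfying it and no other
clause. -/
def MinimalFormula (G : SatFormula V) : Prop :=
  ∀ C ∈ G, ∃ w : V → Bool, SatisfiesClause w C ∧ ∀ C' ∈ G, SatisfiesClause w C' → C' = C

/-- A formula is simple if no two distinct clauses use the same set of variables. -/
def SimpleFormula [DecidableEq V] (G : SatFormula V) : Prop :=
  ∀ C ∈ G, ∀ C' ∈ G, clauseVars C = clauseVars C' → C = C'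

/-- A formula is unate if every variable occurs with only one polarity. -/
def UnateFormula (G : SatFormula V) : Prop :=
  ∀ x : V, ¬ ((∃ C ∈ G, (x, true) ∈ C) ∧ (∃ C ∈ G, (x, false) ∈ C))

/-- The set of variables used by a formula. -/
def formulaVars [DecidableEq V] (G : SatFormula V) : Finset V := G.biUnion clauseVars

/-- `f` is a `k`-SAT function: it is computed by some `k`-SAT formula (value `1` iff some
clause has all its literals satisfied). -/
def IsKSatFunction (k n : ℕ) (f : (Fin n → Bool) → Bool) : Prop :=
  ∃ G : SatFormula (Fin n), IsKFormula k G ∧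
    ∀ a : Fin n → Bool, f a = true ↔ ∃ C ∈ G, SatisfiesClause a C

/-- Relabel the variables of a formula along `φ`. -/
def mapFormula [DecidableEq V] [DecidableEq W] (φ : W → V) (F : SatFormula W) : SatFormula V :=
  F.image (fun C => C.image (fun l => (φ l.1, l.2)))

/-- `G'` is a copy of `F`: it is obtained from `F` by an injective relabeling of variables. -/
def IsCopyOf [DecidableEq V] [DecidableEq W] (F : SatFormula W) (G' : SatFormula V) : Prop :=
  ∃ φ : W → V, Set.InjOn φ ↑(formulaVars F) ∧ G' = mapFormula φ F

/-- The number of copies of `F` in `G`, i.e. of subformulae of `G` isomorphic to `F`. -/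
noncomputable def copyCount [DecidableEq V] [DecidableEq W] (F : SatFormula W)
    (G : SatFormula V) : ℕ :=
  Set.ncard {G' : SatFormula V | G' ⊆ G ∧ IsCopyOf F G'}

/-- The `b`-blowup of a clause: replace each literal by the literal of the same polarity on
one of the `b` duplicates of its variable, in all possible ways. -/
def clauseBlowup [DecidableEq V] (b : ℕ) (C : SatClause V) :
    Finset (SatClause (V × Fin b)) :=
  (C.pi (fun _ => (Finset.univ : Finset (Fin b)))).image
    (fun g => C.attach.image (fun l => ((l.1.1, g l.1 l.2), l.1.2)))

/-- The `b`-blowup of a formula. -/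
def formulaBlowup [DecidableEq V] (b : ℕ) (G : SatFormula V) : SatFormula (V × Fin b) :=
  G.biUnion (clauseBlowup b)

/-- The weight of a formula on `n` variables:
`wt(G) = Σ_i log₂(i+1)·α_i(G)` where `α_i(G)·C(n,k)` counts the `k`-sets of variables
supporting exactly `i` clauses. -/
noncomputable def formulaWt (k n : ℕ) (G : SatFormula (Fin n)) : ℝ :=
  (∑ S ∈ (Finset.univ : Finset (Fin n)).powersetCard k,
    Real.logb 2 (((G.filter (fun C => clauseVars C = S)).card : ℝ) + 1)) / (n.choose k)

/-- A partially directed graph: a set of undirected edges together with a set of directed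
(pointed) edges. -/
structure PDG (V : Type*) where
  undir : Finset (Finset V)
  dir : Finset (Finset V × V)

/-- `H` is a valid `k`-PDG: all edges have `k` vertices, each directed edge is pointed at one
of its vertices, and each `k`-set carries at most one edge (undirected or directed). -/
def PDG.IsValid (k : ℕ) (H : PDG V) : Prop :=
  (∀ e ∈ H.undir, e.card = k) ∧
  (∀ p ∈ H.dir, p.1.card = k ∧ p.2 ∈ p.1) ∧
  (∀ p ∈ H.dir, p.1 ∉ H.undir) ∧
  (∀ p ∈ H.dir, ∀ q ∈ H.dir, p.1 = q.1 → p = q)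

/-- `F` is a subgraph of `H`: a copy of `F` can be obtained from `H` by deleting vertices,
deleting edges, and/or forgetting directions of edges. -/
def PDG.IsSubgraph [DecidableEq V] (F : PDG W) (H : PDG V) : Prop :=
  ∃ φ : W → V, Function.Injective φ ∧
    (∀ e ∈ F.undir, e.image φ ∈ H.undir ∨ ∃ v, (e.image φ, v) ∈ H.dir) ∧
    (∀ p ∈ F.dir, (p.1.image φ, φ p.2) ∈ H.dir)

/-- The image of a PDG under a relabeling of vertices. -/
def PDG.map [DecidableEq V] (φ : W → V) (F : PDG W) : PDG V :=
  ⟨F.undir.image (Finset.image φ), F.dir.image (fun p => (p.1.image φ, φ p.2))⟩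

/-- The PDG `T_k` on vertex set `{0, …, k}` (0-indexed): undirected edges everything-but-`k`
and everything-but-`k-2`, and the edge everything-but-`k-1` directed toward `k`. -/
def TkPDG (k : ℕ) : PDG (Fin (k + 1)) where
  undir := { Finset.univ.erase ⟨k, Nat.lt_succ_self k⟩,
             Finset.univ.erase ⟨k - 2, by omega⟩ }
  dir := { (Finset.univ.erase ⟨k - 1, by omega⟩, ⟨k, Nat.lt_succ_self k⟩) }

/-- A semisimple formula: every `k`-set of variables supports at most one clause, or exactly
two clauses whose polarities differ on exactly one variable. -/
def SemisimpleFormula [DecidableEq V] (G : SatFormula V) : Prop :=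
  ∀ C₁ ∈ G, ∀ C₂ ∈ G, C₁ ≠ C₂ → clauseVars C₁ = clauseVars C₂ →
    (((C₁ \ C₂).image Prod.fst).card = 1 ∧
      ∀ C₃ ∈ G, clauseVars C₃ = clauseVars C₁ → C₃ = C₁ ∨ C₃ = C₂)

/-- The type of a (semisimple) formula: an undirected edge on each variable set supporting
exactly one clause, and for each variable set supporting two clauses a directed edge pointed
at the variable where the two clauses differ. -/
def formulaType [DecidableEq V] (G : SatFormula V) : PDG V where
  undir := (G.filter (fun C => ∀ C' ∈ G, clauseVars C' = clauseVars C → C' = C)).image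
    clauseVars
  dir := ((G ×ˢ G).filter (fun p => p.1 ≠ p.2 ∧ clauseVars p.1 = clauseVars p.2)).biUnion
    (fun p => ((p.1 \ p.2).image Prod.fst).image (fun v => (clauseVars p.1, v)))

end Defs

section TuranTk

variable {V : Type*} [DecidableEq V]

/-- Double counting of pairs consisting of a set and one of its elements. -/
lemma sum_powersetCard_compl_insert [Fintype V] (m : ℕ) (f : Finset V → V → ℝ) :
    ∑ B ∈ (Finset.univ : Finset V).powersetCard m, ∑ v ∈ Bᶜ, f (insert v B) v =
      ∑ e ∈ (Finset.univ : Finset V).powersetCard (m + 1), ∑ v ∈ e, f e v := by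
  rw [Finset.sum_sigma', Finset.sum_sigma']
  refine Finset.sum_bij' (fun p _ => ⟨insert p.2 p.1, p.2⟩) (fun p _ => ⟨p.1.erase p.2, p.2⟩)
    ?_ ?_ ?_ ?_ ?_
  · rintro ⟨B, v⟩ h
    simp only [Finset.mem_sigma, Finset.mem_powersetCard, Finset.mem_compl] at h ⊢
    refine ⟨⟨Finset.subset_univ _, ?_⟩, Finset.mem_insert_self _ _⟩
    rw [Finset.card_insert_of_notMem h.2, h.1.2]
  · rintro ⟨e, v⟩ h
    simp only [Finset.mem_sigma, Finset.mem_powersetCard, Finset.mem_compl] at h ⊢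
    refine ⟨⟨Finset.subset_univ _, ?_⟩, Finset.notMem_erase _ _⟩
    rw [Finset.card_erase_of_mem h.2, h.1.2, Nat.add_sub_cancel]
  · rintro ⟨B, v⟩ h
    simp only [Finset.mem_sigma, Finset.mem_compl] at h
    simp [Finset.erase_insert h.2]
  · rintro ⟨e, v⟩ h
    simp only [Finset.mem_sigma] at h
    simp [Finset.insert_erase h.2]
  · rintro ⟨B, v⟩ _
    rfl

/-- The sum of the squares of the weighted degrees of `m`-sets, split into its diagonal part and
a sum over `(m + 2)`-sets. -/
lemma sum_sq_weighted_degree [Fintype V] (m : ℕ) (ζ : Finset V → V → ℝ) :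
    ∑ B ∈ (Finset.univ : Finset V).powersetCard m, (∑ v ∈ Bᶜ, ζ (insert v B) v) ^ 2 =
      ∑ e ∈ (Finset.univ : Finset V).powersetCard (m + 1), ∑ v ∈ e, ζ e v ^ 2 +
      ∑ S ∈ (Finset.univ : Finset V).powersetCard (m + 2), ∑ w ∈ S, ∑ v ∈ S.erase w,
        ζ (S.erase w) v * ζ (S.erase v) w := by
  have expand : ∀ B ∈ (Finset.univ : Finset V).powersetCard m,
      (∑ v ∈ Bᶜ, ζ (insert v B) v) ^ 2 = ∑ v ∈ Bᶜ, ζ (insert v B) v ^ 2 +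
        ∑ v ∈ Bᶜ, ∑ w ∈ (insert v B)ᶜ,
          ζ (insert v B) v * ζ ((insert w (insert v B)).erase v) w := by
    intro B _
    rw [sq, Finset.sum_mul_sum, ← Finset.sum_add_distrib]
    refine Finset.sum_congr rfl fun v hv => ?_
    rw [← Finset.add_sum_erase _ _ hv, sq, Finset.compl_insert]
    congr 1
    refine Finset.sum_congr rfl fun w hw => ?_
    rw [Finset.mem_erase] at hw
    rw [Finset.insert_comm, Finset.erase_insert]
    simp only [Finset.mem_insert, not_or]
    exact ⟨hw.1.symm, by simpa using hv⟩
  rw [Finset.sum_congr rfl expand, Finset.sum_add_distrib]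
  congr 1
  · exact sum_powersetCard_compl_insert m fun e v => ζ e v ^ 2
  · rw [sum_powersetCard_compl_insert m
      fun e v => ∑ w ∈ eᶜ, ζ e v * ζ ((insert w e).erase v) w,
      ← sum_powersetCard_compl_insert (m + 1)
        fun S w => ∑ v ∈ S.erase w, ζ (S.erase w) v * ζ (S.erase v) w]
    refine Finset.sum_congr rfl fun e _ => ?_
    rw [Finset.sum_comm]
    refine Finset.sum_congr rfl fun w hw => ?_
    rw [Finset.erase_insert (by simpa using hw)]


/-- The parameters of the quadratic form used for the local inequality exist when `4 ≤ k`. -/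
lemma exists_quadratic_parameters (k : ℕ) (hk : 4 ≤ k) :
    ∃ s r : ℝ, 0 < s ∧ 0 ≤ r ∧ s * k ≤ 1 ∧ 2 * s * r = 1 / √2 - 1 / k ∧
      s * ((k - 1) * (k - 2) + 2 * r ^ 2) ≤ k - 1 - 2 * (1 / √2) := by
  have hk' : (4 : ℝ) ≤ k := by exact_mod_cast hk
  set K : ℝ := (k : ℝ)
  have hq : √2 ^ 2 = 2 := Real.sq_sqrt (by norm_num)
  have hq0 : 0 < √2 := by positivity
  have hq1 : √2 < 1.41422 := by rw [Real.sqrt_lt' (by norm_num)]; norm_num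
  have hq2 : 1.41421 < √2 := Real.lt_sqrt_of_sq_lt (by norm_num)
  have hinv : 1 / √2 = √2 / 2 := by field_simp; linarith
  rw [hinv]
  set q := √2
  have hK1 : 0 < K - 1 := by linarith
  have hK2 : 0 < K - 2 := by linarith
  have hKq : 0 < K - 1 - q := by linarith
  set s : ℝ := (K - 1 - q) / (2 * ((K - 1) * (K - 2))) with hs
  set g : ℝ := q / 2 - 1 / K with hg
  have hs0 : 0 < s := by positivity
  have hg0 : 0 ≤ g := by
    rw [hg, sub_nonneg, div_le_div_iff₀ (by linarith) (by norm_num)]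
    nlinarith
  refine ⟨s, g / (2 * s), hs0, by positivity, ?_, by field_simp, ?_⟩
  · rw [hs, div_mul_eq_mul_div, div_le_one (by positivity)]
    nlinarith [sq_nonneg (K - 4)]
  · have hsA : s * ((K - 1) * (K - 2)) = (K - 1 - q) / 2 := by
      rw [hs]; field_simp
    have key : 2 * g ^ 2 * ((K - 1) * (K - 2)) ≤ (K - 1 - q) ^ 2 := by
      have hgK : g = (q * K - 2) / (2 * K) := by rw [hg]; field_simp
      rw [hgK, div_pow, mul_div_assoc', div_mul_eq_mul_div, div_le_iff₀ (by positivity)]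
      obtain ⟨m, hm⟩ : ∃ m, K = 4 + m := ⟨K - 4, by ring⟩
      have hm0 : 0 ≤ m := by linarith
      have cubic : 0 ≤ K ^ 3 - (1 + 4 * q) * K ^ 2 + (6 + 4 * q) * K - 4 := by
        rw [hm]
        nlinarith [mul_nonneg hm0 (sub_nonneg.2 hq1.le), pow_nonneg hm0 3,
          mul_nonneg (pow_nonneg hm0 2) (sub_nonneg.2 hq1.le), pow_nonneg hm0 2]
      have id1 : (K - 1 - q) ^ 2 * (2 * K) ^ 2 - 2 * (q * K - 2) ^ 2 * ((K - 1) * (K - 2)) =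
          4 * (K ^ 3 - (1 + 4 * q) * K ^ 2 + (6 + 4 * q) * K - 4) +
          (q ^ 2 - 2) * (4 * K ^ 2 - 2 * K ^ 2 * ((K - 1) * (K - 2))) := by ring
      rw [hq] at id1
      linarith
    have hr : s * (2 * (g / (2 * s)) ^ 2) ≤ (K - 1 - q) / 2 := by
      have h1 : s * (2 * (g / (2 * s)) ^ 2) = g ^ 2 / (2 * s) := by field_simp
      rw [h1, div_le_iff₀ (by positivity)]
      have h2 : (K - 1 - q) / 2 * (2 * s) * (2 * ((K - 1) * (K - 2))) = (K - 1 - q) ^ 2 := by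
        linear_combination 2 * (K - 1 - q) * hsA
      have hP : 0 < 2 * ((K - 1) * (K - 2)) := by positivity
      refine le_of_mul_le_mul_right ?_ hP
      rw [h2]; linarith
    linarith

/-- The local inequality on a `(k + 1)`-set `S`, where `y w` indicates that `S.erase w` is not an
edge and `x w v` that it is directed toward `v`. -/
lemma local_quadratic_le {k : ℕ} (hk : 4 ≤ k) {s r : ℝ} (hs : 0 < s) (hr : 0 ≤ r)
    (hsk : s * k ≤ 1) (hsr : 2 * s * r = 1 / √2 - 1 / k)
    (hkey : s * ((k - 1) * (k - 2) + 2 * r ^ 2) ≤ k - 1 - 2 * (1 / √2))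
    {S : Finset V} (hS : S.card = k + 1) {y : V → ℝ} {x : V → V → ℝ}
    (hy : ∀ w, y w = 0 ∨ y w = 1) (hx : ∀ w v, x w v = 0 ∨ x w v = 1)
    (hxy : ∀ w ∈ S, y w + ∑ v ∈ S.erase w, x w v ≤ 1)
    (hfree : ∀ c ∈ S, ∀ a ∈ S, a ≠ c → x c a = 1 → y a = 0 →
      ∀ b ∈ S, b ≠ a → b ≠ c → y b = 1) :
    s * ∑ w ∈ S, ∑ v ∈ S.erase w, (y w - r * x w v) * (y v - r * x v w) ≤
      ∑ w ∈ S, (y w - 1 / √2 * ∑ v ∈ S.erase w, x w v) := by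
  have hk' : (4 : ℝ) ≤ k := by exact_mod_cast hk
  have hq0 : 0 < 1 / √2 := by positivity
  have hy0 : ∀ w, 0 ≤ y w := fun w => by rcases hy w with h | h <;> simp [h]
  have hx0 : ∀ w v, 0 ≤ x w v := fun w v => by rcases hx w v with h | h <;> simp [h]
  have hxle : ∀ w ∈ S, ∀ v ∈ S.erase w, x w v ≤ 1 - y w := fun w hw v hv => by
    have := Finset.single_le_sum (f := fun v => x w v) (fun v _ => hx0 w v) hv
    linarith [hxy w hw]
  set t : ℝ := ∑ w ∈ S, y w with ht
  set D : ℝ := ∑ w ∈ S, ∑ v ∈ S.erase w, x w v with hD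
  have hrhs : ∑ w ∈ S, (y w - 1 / √2 * ∑ v ∈ S.erase w, x w v) = t - 1 / √2 * D := by
    rw [Finset.sum_sub_distrib, ← Finset.mul_sum]
  have hDt : D ≤ k + 1 - t := by
    have := Finset.sum_le_sum hxy
    rw [Finset.sum_add_distrib, Finset.sum_const, hS] at this
    push_cast [nsmul_eq_mul] at this
    linarith
  have hswap : ∀ f : V → V → ℝ, ∑ w ∈ S, ∑ v ∈ S.erase w, f v w =
      ∑ w ∈ S, ∑ v ∈ S.erase w, f w v := fun f =>
    Finset.sum_comm' (by intro a b; simp only [Finset.mem_erase]; tauto)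
  have hoff : ∀ f : V → ℝ, (∀ w, f w = 0 ∨ f w = 1) →
      ∑ w ∈ S, ∑ v ∈ S.erase w, f w * f v = (∑ w ∈ S, f w) * (∑ w ∈ S, f w - 1) := by
    intro f hf
    rw [mul_sub, mul_one, Finset.sum_mul_sum, ← Finset.sum_sub_distrib]
    refine Finset.sum_congr rfl fun w hw => ?_
    rw [← Finset.add_sum_erase _ _ hw]
    rcases hf w with h | h <;> simp [h]
  rw [hrhs]
  by_cases hB : ∃ c ∈ S, ∃ a ∈ S, a ≠ c ∧ x c a = 1 ∧ y a = 0
  · obtain ⟨c, hc, a, ha, hac, hxca, hya⟩ := hB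
    have hyc : y c = 0 := by
      have := hxle c hc a (Finset.mem_erase.2 ⟨hac, ha⟩)
      linarith [hy0 c]
    have htk : t = k - 1 := by
      have hca : c ∈ S.erase a := Finset.mem_erase.2 ⟨hac.symm, hc⟩
      rw [ht, ← Finset.add_sum_erase _ _ ha, ← Finset.add_sum_erase _ _ hca, hya, hyc,
        Finset.sum_congr rfl (g := fun _ => (1 : ℝ)), Finset.sum_const,
        Finset.card_erase_of_mem hca, Finset.card_erase_of_mem ha, hS]
      · rw [Nat.add_sub_cancel, nsmul_eq_mul, Nat.cast_sub (by omega)]; simp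
      · intro b hb
        simp only [Finset.mem_erase] at hb
        exact hfree c hc a ha hac hxca hya b hb.2.2 hb.2.1 hb.1
    have hbound : ∑ w ∈ S, ∑ v ∈ S.erase w, (y w - r * x w v) * (y v - r * x v w) ≤
        ∑ w ∈ S, ∑ v ∈ S.erase w, (y w * y v + r ^ 2 * ((1 - y w) * (1 - y v))) := by
      refine Finset.sum_le_sum fun w hw => Finset.sum_le_sum fun v hv => ?_
      have hwv : w ∈ S.erase v :=
        Finset.mem_erase.2 ⟨(Finset.ne_of_mem_erase hv).symm, hw⟩
      have h1 := hxle w hw v hv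
      have h2 := hxle v (Finset.mem_of_mem_erase hv) w hwv
      have h3 : x w v * x v w ≤ (1 - y w) * (1 - y v) :=
        mul_le_mul h1 h2 (hx0 _ _) ((hx0 _ _).trans h1)
      have h4 := mul_le_mul_of_nonneg_left h3 (sq_nonneg r)
      have h5 := mul_nonneg hr (mul_nonneg (hx0 w v) (hy0 v))
      have h6 := mul_nonneg hr (mul_nonneg (hx0 v w) (hy0 w))
      nlinarith
    have hcompl : ∑ w ∈ S, (1 - y w) = 2 := by
      rw [Finset.sum_sub_distrib, Finset.sum_const, hS, ← ht, htk]
      push_cast [nsmul_eq_mul]; ring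
    simp only [Finset.sum_add_distrib, ← Finset.mul_sum] at hbound
    have e1 := hoff y hy
    have e2 := hoff (fun w => 1 - y w) fun w => by rcases hy w with h | h <;> simp [h]
    simp only [← Finset.mul_sum] at e1 e2
    rw [e1, e2, ← ht, htk, hcompl] at hbound
    have h7 := mul_le_mul_of_nonneg_left hbound hs.le
    have hD2 : D ≤ 2 := by linarith
    have h8 := mul_le_mul_of_nonneg_left hD2 hq0.le
    rw [htk]
    nlinarith
  · push Not at hB
    have hxyv : ∀ w ∈ S, ∀ v ∈ S.erase w, x w v = 0 ∨ y v = 1 := fun w hw v hv => by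
      rw [Finset.mem_erase] at hv
      rcases hx w v with h | h
      · exact Or.inl h
      · exact Or.inr ((hy v).resolve_left (hB w hw v hv.2 hv.1 h))
    have hterm : ∀ w ∈ S, ∀ v ∈ S.erase w, (y w - r * x w v) * (y v - r * x v w) =
        y w * y v - r * (x w v + x v w) := fun w hw v hv => by
      have hv' := Finset.mem_of_mem_erase hv
      have hwv : w ∈ S.erase v :=
        Finset.mem_erase.2 ⟨(Finset.ne_of_mem_erase hv).symm, hw⟩
      have h1 := hxle w hw v hv
      have h2 := hxle v hv' w hwv
      rcases hxyv w hw v hv with h | h <;> rcases hxyv v hv' w hwv with h' | h'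
      · simp [h, h']
      · rw [h, h']; ring
      · rw [h, h']; ring
      · have e1 : x w v = 0 := le_antisymm (by linarith) (hx0 _ _)
        have e2 : x v w = 0 := le_antisymm (by linarith) (hx0 _ _)
        simp [e1, e2]
    rw [Finset.sum_congr rfl fun w hw => Finset.sum_congr rfl (hterm w hw)]
    simp only [Finset.sum_sub_distrib, ← Finset.mul_sum, Finset.sum_add_distrib]
    have e1 := hoff y hy
    simp only [← Finset.mul_sum] at e1
    rw [e1, hswap x, ← ht, ← hD]
    have hDkt : D ≤ k * t := by
      calc D ≤ ∑ w ∈ S, ∑ v ∈ S.erase w, y v := by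
            refine Finset.sum_le_sum fun w hw => Finset.sum_le_sum fun v hv => ?_
            rcases hxyv w hw v hv with h | h
            · rw [h]; exact hy0 v
            · rw [h]; linarith [hxle w hw v hv, hy0 w]
        _ = k * t := by
            rw [hswap fun w _ => y w]
            simp only [Finset.sum_const]
            rw [ht, Finset.mul_sum]
            refine Finset.sum_congr rfl fun w hw => ?_
            rw [Finset.card_erase_of_mem hw, hS, Nat.add_sub_cancel, nsmul_eq_mul]
    have hlin : s * (t * (t - 1)) ≤ t - D / k := by
      have hkpos : (0 : ℝ) < k := by linarith
      have hnat : t = ((S.filter fun w => y w = 1).card : ℝ) := by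
        rw [ht, Finset.card_filter, Nat.cast_sum]
        refine Finset.sum_congr rfl fun w _ => ?_
        rcases hy w with h | h <;> simp [h]
      have hD0 : 0 ≤ D := Finset.sum_nonneg fun w _ => Finset.sum_nonneg fun v _ => hx0 w v
      rcases Nat.eq_zero_or_pos (S.filter fun w => y w = 1).card with h | h
      · have ht0 : t = 0 := by rw [hnat, h]; simp
        have : D = 0 := le_antisymm (by simpa [ht0] using hDkt) hD0
        simp [ht0, this]
      · have ht1 : 1 ≤ t := by rw [hnat]; exact_mod_cast h
        have h1 : D / k ≤ (k + 1 - t) / k := by gcongr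
        have h2 : t - (k + 1 - t) / k = (t - 1) * ((k + 1) / k) := by field_simp; ring
        have h3 : s * t ≤ (k + 1) / k := by
          rw [le_div_iff₀ hkpos]
          have : s * k * t ≤ 1 * t := mul_le_mul_of_nonneg_right hsk (by linarith)
          linarith
        have h4 := mul_le_mul_of_nonneg_left h3 (sub_nonneg.2 ht1)
        linarith
    have hfin : 2 * s * r * D = (1 / √2 - 1 / k) * D := by rw [hsr]
    have hdk : D / k = 1 / k * D := by ring
    rw [hdk] at hlin
    linarith

namespace PDG

/-- A `k`-set carries an edge of either kind. -/
def HasEdge (H : PDG V) (e : Finset V) : Prop := e ∈ H.undir ∨ ∃ v, (e, v) ∈ H.dir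

open Classical in
/-- Indicator of the absence of an edge. -/
noncomputable def nonedgeInd (H : PDG V) (e : Finset V) : ℝ := if H.HasEdge e then 0 else 1

/-- Indicator of the edge being directed toward `v`. -/
def dirInd (H : PDG V) (e : Finset V) (v : V) : ℝ := if (e, v) ∈ H.dir then 1 else 0

lemma nonedgeInd_add_dirInd_le {k : ℕ} {H : PDG V} (hH : H.IsValid k) (e : Finset V) :
    H.nonedgeInd e + ∑ v ∈ e, H.dirInd e v + (if e ∈ H.undir then 1 else 0) ≤ 1 := by
  obtain ⟨-, -, hdu, huniq⟩ := hH
  by_cases hu : e ∈ H.undir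
  · have h0 : ∀ v ∈ e, H.dirInd e v = 0 := fun v _ =>
      if_neg fun h => hdu _ h hu
    rw [Finset.sum_eq_zero h0, nonedgeInd, if_pos (show H.HasEdge e from Or.inl hu), if_pos hu]
    norm_num
  by_cases hd : ∃ v, (e, v) ∈ H.dir
  · obtain ⟨v, hv⟩ := hd
    have h0 : ∀ w ∈ e, H.dirInd e w ≤ if w = v then 1 else 0 := fun w _ => by
      unfold dirInd
      by_cases h : (e, w) ∈ H.dir
      · have : w = v := congrArg Prod.snd (huniq _ h _ hv rfl)
        simp [this, hv]
      · rw [if_neg h]; split_ifs <;> norm_num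
    have h1 := Finset.sum_le_sum h0
    rw [Finset.sum_ite_eq'] at h1
    rw [nonedgeInd, if_pos (show H.HasEdge e from Or.inr ⟨v, hv⟩), if_neg hu]
    have h2 : (if v ∈ e then (1 : ℝ) else 0) ≤ 1 := by split_ifs <;> norm_num
    linarith
  · have h0 : ∀ v ∈ e, H.dirInd e v = 0 := fun v _ => if_neg fun h => hd ⟨v, h⟩
    rw [Finset.sum_eq_zero h0, nonedgeInd, if_neg (show ¬ H.HasEdge e from not_or.2 ⟨hu, hd⟩),
      if_neg hu]
    norm_num

lemma sum_dirInd [Fintype V] {k : ℕ} {H : PDG V} (hH : H.IsValid k) :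
    ∑ e ∈ (Finset.univ : Finset V).powersetCard k, ∑ v ∈ e, H.dirInd e v = H.dir.card := by
  have h1 : ∀ e ∈ (Finset.univ : Finset V).powersetCard k,
      ∑ v ∈ e, H.dirInd e v = ∑ v, H.dirInd e v := fun e _ =>
    Finset.sum_subset (Finset.subset_univ e) fun v _ hv =>
      if_neg fun h => hv (hH.2.1 _ h).2
  rw [Finset.sum_congr rfl h1, ← Finset.sum_product']
  simp only [dirInd, Prod.mk.eta]
  rw [Finset.sum_boole, Finset.filter_mem_eq_inter, Finset.inter_eq_right.2]
  intro p hp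
  simp [(hH.2.1 p hp).1]

lemma sum_undirInd [Fintype V] {k : ℕ} {H : PDG V} (hH : H.IsValid k) :
    ∑ e ∈ (Finset.univ : Finset V).powersetCard k, (if e ∈ H.undir then (1 : ℝ) else 0) =
      H.undir.card := by
  rw [Finset.sum_boole, Finset.filter_mem_eq_inter, Finset.inter_eq_right.2]
  intro e he
  simp [hH.1 e he]

/-- In a `T_k`-free PDG, a `(k + 1)`-set with a directed edge `S.erase c` toward `a` cannot have
both `S.erase a` and `S.erase b` as further edges. -/
lemma not_hasEdge_of_free {k : ℕ} (hk : 2 ≤ k) {H : PDG V}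
    (hfree : ¬ (TkPDG k).IsSubgraph H) {S : Finset V} (hS : S.card = k + 1) {a b c : V}
    (ha : a ∈ S) (hb : b ∈ S) (hc : c ∈ S) (hac : a ≠ c) (hba : b ≠ a) (hbc : b ≠ c)
    (hdir : (S.erase c, a) ∈ H.dir) (hea : H.HasEdge (S.erase a)) :
    ¬ H.HasEdge (S.erase b) := by
  intro heb
  apply hfree
  let p : Fin (k + 1) := ⟨k, by omega⟩
  let q : Fin (k + 1) := ⟨k - 1, by omega⟩
  let o : Fin (k + 1) := ⟨k - 2, by omega⟩
  have hqp : q ≠ p := by simp only [p, q, ne_eq, Fin.mk.injEq]; omega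
  have hop : o ≠ p := by simp only [p, o, ne_eq, Fin.mk.injEq]; omega
  have hoq : o ≠ q := by simp only [o, q, ne_eq, Fin.mk.injEq]; omega
  let f : Fin (k + 1) → V := fun i => if i = p then a else if i = q then c else b
  have hfp : f p = a := by simp [f]
  have hfq : f q = c := by simp [f, hqp]
  have hfo : f o = b := by simp [f, hop, hoq]
  obtain ⟨e, he⟩ := Finset.exists_equiv_extend_of_card_eq (t := S) (s := {p, q, o}) (f := f)
    (by simp [hS])
    (by
      intro v hv
      simp only [Finset.image_insert, Finset.image_singleton, hfp, hfq, hfo,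
        Finset.mem_insert, Finset.mem_singleton] at hv
      rcases hv with rfl | rfl | rfl <;> assumption)
    (by
      intro i hi j hj hij
      simp only [Finset.coe_insert, Finset.coe_singleton, Set.mem_insert_iff,
        Set.mem_singleton_iff] at hi hj
      rcases hi with rfl | rfl | rfl <;> rcases hj with rfl | rfl | rfl <;>
        simp_all)
  let φ : Fin (k + 1) → V := fun i => e i
  have hφ : Function.Injective φ := Subtype.val_injective.comp e.injective
  have hφp : φ p = a := (he p (by simp)).trans hfp
  have hφq : φ q = c := (he q (by simp)).trans hfq
  have hφo : φ o = b := (he o (by simp)).trans hfo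
  have himg : ∀ i, (Finset.univ.erase i).image φ = S.erase (φ i) := fun i => by
    rw [Finset.image_erase hφ]
    congr 1
    ext v
    simp only [Finset.mem_image, Finset.mem_univ, true_and]
    constructor
    · rintro ⟨j, rfl⟩
      exact (e j).2
    · intro hv
      exact ⟨e.symm ⟨v, hv⟩, by simp [φ]⟩
  refine ⟨φ, hφ, ?_, ?_⟩
  · intro u hu
    simp only [TkPDG, Finset.mem_insert, Finset.mem_singleton] at hu
    rcases hu with rfl | rfl
    · rw [himg, show φ ⟨k, _⟩ = a from hφp]; exact hea
    · rw [himg, show φ ⟨k - 2, _⟩ = b from hφo]; exact heb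
  · intro u hu
    simp only [TkPDG, Finset.mem_singleton] at hu
    subst hu
    rw [himg, show φ ⟨k - 1, _⟩ = c from hφq, show φ ⟨k, _⟩ = a from hφp]
    exact hdir

/-- The Turán-type bound with an explicit error term. -/
lemma weighted_nonedges_ge [Fintype V] {k : ℕ} (hk : 4 ≤ k) {s r : ℝ} (hs : 0 < s) (hr : 0 ≤ r)
    (hsk : s * k ≤ 1) (hsr : 2 * s * r = 1 / √2 - 1 / k)
    (hkey : s * ((k - 1) * (k - 2) + 2 * r ^ 2) ≤ k - 1 - 2 * (1 / √2))
    {H : PDG V} (hH : H.IsValid k) (hfree : ¬ (TkPDG k).IsSubgraph H)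
    (hn : k ≤ Fintype.card V) :
    0 ≤ s * (k * (1 + r ^ 2)) * (Fintype.card V).choose k +
      ((Fintype.card V : ℝ) - k) * ((Fintype.card V).choose k -
        (H.undir.card + (1 + 1 / √2) * H.dir.card)) := by
  set ζ : Finset V → V → ℝ := fun e v => H.nonedgeInd e - r * H.dirInd e v with hζ
  set ω : Finset V → ℝ := fun e => H.nonedgeInd e - 1 / √2 * ∑ v ∈ e, H.dirInd e v with hω
  have hy : ∀ e, H.nonedgeInd e = 0 ∨ H.nonedgeInd e = 1 := fun e => by
    unfold nonedgeInd; split_ifs <;> simp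
  have hx : ∀ e v, H.dirInd e v = 0 ∨ H.dirInd e v = 1 := fun e v => by
    unfold dirInd; split_ifs <;> simp
  have hcard : ∑ e ∈ (Finset.univ : Finset V).powersetCard k, (1 : ℝ) =
      (Fintype.card V).choose k := by simp
  have hdiag : ∑ e ∈ (Finset.univ : Finset V).powersetCard k, ∑ v ∈ e, ζ e v ^ 2 ≤
      k * (1 + r ^ 2) * (Fintype.card V).choose k := by
    rw [← hcard, Finset.mul_sum]
    refine Finset.sum_le_sum fun e he => ?_
    rw [mul_one, ← (Finset.mem_powersetCard.1 he).2, ← nsmul_eq_mul, ← Finset.sum_const]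
    refine Finset.sum_le_sum fun v _ => ?_
    simp only [hζ]
    rcases hy e with h | h <;> rcases hx e v with h' | h' <;> rw [h, h'] <;>
      nlinarith [sq_nonneg r]
  have hlocal : s * ∑ S ∈ (Finset.univ : Finset V).powersetCard (k + 1), ∑ w ∈ S,
      ∑ v ∈ S.erase w, ζ (S.erase w) v * ζ (S.erase v) w ≤
      ∑ S ∈ (Finset.univ : Finset V).powersetCard (k + 1), ∑ w ∈ S, ω (S.erase w) := by
    rw [Finset.mul_sum]
    refine Finset.sum_le_sum fun S hS => ?_
    have hS' := (Finset.mem_powersetCard.1 hS).2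
    refine local_quadratic_le hk hs hr hsk hsr hkey hS' (y := fun w => H.nonedgeInd (S.erase w))
      (x := fun w v => H.dirInd (S.erase w) v) (fun w => hy _) (fun w v => hx _ _) ?_ ?_
    · intro w _
      have h1 := nonedgeInd_add_dirInd_le hH (S.erase w)
      have h2 : (0 : ℝ) ≤ if S.erase w ∈ H.undir then 1 else 0 := by split_ifs <;> norm_num
      linarith
    · intro c hc a ha hac hca hya b hb hba hbc
      have h1 : (S.erase c, a) ∈ H.dir := by
        by_contra h
        simp [dirInd, h] at hca
      have h2 : H.HasEdge (S.erase a) := by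
        by_contra h
        simp [nonedgeInd, h] at hya
      exact if_neg (not_hasEdge_of_free (by omega) hfree hS' ha hb hc hac hba hbc h1 h2)
  have hcount : ∑ S ∈ (Finset.univ : Finset V).powersetCard (k + 1), ∑ w ∈ S, ω (S.erase w) =
      ((Fintype.card V : ℝ) - k) * ∑ e ∈ (Finset.univ : Finset V).powersetCard k, ω e := by
    rw [← sum_powersetCard_compl_insert k fun S w => ω (S.erase w), Finset.mul_sum]
    refine Finset.sum_congr rfl fun e he => ?_
    have h1 : ∀ v ∈ eᶜ, ω ((insert v e).erase v) = ω e := fun v hv => by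
      rw [Finset.erase_insert (by simpa using hv)]
    rw [Finset.sum_congr rfl h1, Finset.sum_const, Finset.card_compl,
      (Finset.mem_powersetCard.1 he).2, nsmul_eq_mul, Nat.cast_sub hn]
  have hωle : ∑ e ∈ (Finset.univ : Finset V).powersetCard k, ω e ≤
      (Fintype.card V).choose k - (H.undir.card + (1 + 1 / √2) * H.dir.card) := by
    have h1 := Finset.sum_le_sum fun e (_ : e ∈ (Finset.univ : Finset V).powersetCard k) =>
      nonedgeInd_add_dirInd_le hH e
    rw [Finset.sum_add_distrib, Finset.sum_add_distrib, sum_dirInd hH, sum_undirInd hH,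
      hcard] at h1
    simp only [hω]
    rw [Finset.sum_sub_distrib, ← Finset.mul_sum, sum_dirInd hH]
    linarith
  obtain ⟨m, rfl⟩ : ∃ m, k = m + 1 := ⟨k - 1, by omega⟩
  have hsq := Finset.sum_nonneg
    fun B (_ : B ∈ (Finset.univ : Finset V).powersetCard m) =>
      sq_nonneg (∑ v ∈ Bᶜ, ζ (insert v B) v)
  rw [sum_sq_weighted_degree] at hsq
  have h1 := mul_nonneg hs.le hsq
  have h2 := mul_le_mul_of_nonneg_left hdiag hs.le
  have h3 := mul_le_mul_of_nonneg_left hωle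
    (sub_nonneg.2 (by exact_mod_cast hn : ((m + 1 : ℕ) : ℝ) ≤ Fintype.card V))
  rw [hcount] at hlocal
  rw [mul_add] at h1
  linarith

end PDG

end TuranTk

/-- For `k ≥ 4` and `θ = 1 + 1/√2`, `π(T_k, θ) = 1`: for every `ε > 0` there
is `n₀` such that every `T_k`-free `k`-PDG on `n ≥ n₀` vertices satisfies
`e_u(H) + θ·e_d(H) ≤ (1+ε)·C(n,k)`. -/
theorem turan_Tk_theta (k : ℕ) (hk : 4 ≤ k) (ε : ℝ) (hε : 0 < ε) :
    ∃ n₀ : ℕ, ∀ n ≥ n₀, ∀ H : PDG (Fin n),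
      H.IsValid k → ¬ (TkPDG k).IsSubgraph H →
      (H.undir.card : ℝ) + (1 + 1 / Real.sqrt 2) * H.dir.card ≤ (1 + ε) * n.choose k := by
  obtain ⟨s, r, hs, hr, hsk, hsr, hkey⟩ := exists_quadratic_parameters k hk
  set K : ℝ := s * (k * (1 + r ^ 2)) with hK
  refine ⟨k + ⌈K / ε⌉₊ + 1, fun n hn H hH hfree => ?_⟩
  have hbound := PDG.weighted_nonedges_ge hk hs hr hsk hsr hkey hH hfree
    (by rw [Fintype.card_fin]; omega)
  rw [Fintype.card_fin, ← hK] at hbound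
  have hnk : K / ε < (n : ℝ) - k := by
    have h1 : ((k + ⌈K / ε⌉₊ + 1 : ℕ) : ℝ) ≤ n := by exact_mod_cast hn
    push_cast at h1
    linarith [Nat.le_ceil (K / ε)]
  have hpos : 0 < (n : ℝ) - k := lt_of_le_of_lt (by positivity) hnk
  have hKε : K ≤ ((n : ℝ) - k) * ε := ((div_lt_iff₀ hε).1 hnk).le
  have h2 : K * n.choose k ≤ ((n : ℝ) - k) * ε * n.choose k :=
    mul_le_mul_of_nonneg_right hKε (Nat.cast_nonneg _)
  refine le_of_mul_le_mul_left ?_ hpos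
  nlinarith
end

section
/- Let k ≥ 1 be an integer and β ≥ 0 a real number. Every k-uniform hypergraph on n vertices with at most β·n^k/k! edges contains at most β^{(k+1)/k}·n^{k+1}/(k+1)! simplices, where a simplex is a set of k+1 vertices all of whose k-element subsets are edges of the hypergraph. -/
/-- The sizes of the links of all points add up to the total size of the sets in the family. -/
lemma sum_card_memberSubfamily {α : Type*} [DecidableEq α] [Fintype α] {m : ℕ}
    {T : Finset (Finset α)} (hT : ∀ s ∈ T, s.card = m) :
    ∑ v, (T.memberSubfamily v).card = m * T.card := by
  have hcard : ∀ v, (T.memberSubfamily v).card = (T.filter (v ∈ ·)).card := fun v =>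
    Finset.card_image_of_injOn <| (Finset.erase_injOn' v).mono fun s hs => by
      simpa using (Finset.mem_filter.mp hs).2
  simp_rw [hcard, Finset.card_filter]
  rw [Finset.sum_comm]
  calc ∑ s ∈ T, ∑ v, (if v ∈ s then 1 else 0) = ∑ s ∈ T, m :=
        Finset.sum_congr rfl fun s hs => by simp [hT s hs]
    _ = m * T.card := by simp [mul_comm]

/-- A Loomis-Whitney type bound for a family `T` of `(k+1)`-sets whose shadow lies in `G`. The
factor `T.card` on both sides only serves to make the statement true for `k = 0`. -/
lemma factorial_mul_card_pow_mul_card_le {α : Type*} [DecidableEq α] [Fintype α] (k : ℕ)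
    (G T : Finset (Finset α)) (hG : ∀ e ∈ G, e.card = k) (hT : ∀ s ∈ T, s.card = k + 1)
    (hTG : ∀ s ∈ T, ∀ v ∈ s, s.erase v ∈ G) :
    ((k + 1).factorial * T.card) ^ k * T.card ≤ (k.factorial * G.card) ^ (k + 1) * T.card := by
  induction k generalizing G T with
  | zero =>
    rcases T.eq_empty_or_nonempty with rfl | ⟨s, hs⟩
    · simp
    · obtain ⟨v, hv⟩ : s.Nonempty := Finset.card_pos.mp (by simp [hT s hs])
      have : 0 < G.card := Finset.card_pos.mpr ⟨_, hTG s hs v hv⟩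
      simpa using Nat.le_mul_of_pos_left T.card this
  | succ k ih =>
    refine Nat.mul_le_mul_right _ ?_
    have hlink : ∀ v, ((k + 1).factorial * (T.memberSubfamily v).card) ^ (k + 1) ≤
        (k.factorial * (G.memberSubfamily v).card) ^ (k + 1) * ((k + 1).factorial * G.card) := by
      intro v
      have hle : (T.memberSubfamily v).card ≤ G.card := by
        refine Finset.card_le_card fun s hs => ?_
        obtain ⟨hs, hv⟩ := Finset.mem_memberSubfamily.mp hs
        simpa [hv] using hTG _ hs v (Finset.mem_insert_self _ _)
      have hind := ih (G.memberSubfamily v) (T.memberSubfamily v)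
        (fun e he => by
          obtain ⟨he, hv⟩ := Finset.mem_memberSubfamily.mp he
          simpa [hv] using hG _ he)
        (fun s hs => by
          obtain ⟨hs, hv⟩ := Finset.mem_memberSubfamily.mp hs
          simpa [hv] using hT _ hs)
        (fun s hs w hw => by
          obtain ⟨hs, hv⟩ := Finset.mem_memberSubfamily.mp hs
          have hvw : v ≠ w := fun h => hv (h ▸ hw)
          refine Finset.mem_memberSubfamily.mpr ⟨?_, fun h => hv (Finset.mem_of_mem_erase h)⟩
          rw [← Finset.erase_insert_of_ne hvw]
          exact hTG _ hs w (Finset.mem_insert_of_mem hw))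
      calc _ = (k + 1).factorial * (((k + 1).factorial * (T.memberSubfamily v).card) ^ k *
              (T.memberSubfamily v).card) := by ring
        _ ≤ (k + 1).factorial * ((k.factorial * (G.memberSubfamily v).card) ^ (k + 1) *
              G.card) := Nat.mul_le_mul_left _ (hind.trans (Nat.mul_le_mul_left _ hle))
        _ = _ := by ring
    set c : ℝ := (((k + 1).factorial * G.card : ℕ) : ℝ) ^ (((k + 1 : ℕ) : ℝ)⁻¹)
    have hc0 : 0 ≤ c := by positivity
    have hc : c ^ (k + 1) = (((k + 1).factorial * G.card : ℕ) : ℝ) :=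
      Real.rpow_inv_natCast_pow (by positivity) k.succ_ne_zero
    have hroot : ∀ v, ((k + 1).factorial : ℝ) * (T.memberSubfamily v).card ≤
        k.factorial * (G.memberSubfamily v).card * c := by
      intro v
      refine le_of_pow_le_pow_left₀ k.succ_ne_zero (by positivity) ?_
      rw [Nat.succ_eq_add_one, mul_pow _ c, hc]
      exact_mod_cast hlink v
    have hsum := Finset.sum_le_sum fun v (_ : v ∈ Finset.univ) => hroot v
    rw [← Finset.sum_mul, ← Finset.mul_sum, ← Finset.mul_sum, ← Nat.cast_sum, ← Nat.cast_sum,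
      sum_card_memberSubfamily hT, sum_card_memberSubfamily hG] at hsum
    have hmain : (((k + 1 + 1).factorial * T.card : ℕ) : ℝ) ≤
        ((k + 1).factorial * G.card : ℕ) * c := by
      rw [Nat.factorial_succ (k + 1)]
      conv_rhs => rw [Nat.factorial_succ k]
      push_cast at hsum ⊢
      linarith
    have hpow := pow_le_pow_left₀ (by positivity) hmain (k + 1)
    rw [mul_pow _ c, hc, ← pow_succ] at hpow
    exact_mod_cast hpow

/-- **Kruskal–Katona, special case.** Every `k`-uniform hypergraph on `n`
vertices with at most `β·n^k/k!` edges contains at most `β^((k+1)/k)·n^(k+1)/(k+1)!`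
simplices (sets of `k+1` vertices all of whose `k`-subsets are edges). -/
theorem kruskal_katona_simplices (k n : ℕ) (hk : 1 ≤ k) (β : ℝ) (hβ : 0 ≤ β)
    (G : Finset (Finset (Fin n))) (hunif : ∀ e ∈ G, e.card = k)
    (hcard : (G.card : ℝ) ≤ β * n ^ k / (Nat.factorial k)) :
    (((((Finset.univ : Finset (Fin n)).powersetCard (k + 1)).filter
          (fun S => ∀ t ∈ S.powersetCard k, t ∈ G)).card : ℝ)) ≤
      β ^ (((k : ℝ) + 1) / k) * n ^ (k + 1) / (Nat.factorial (k + 1)) := by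
  set T := ((Finset.univ : Finset (Fin n)).powersetCard (k + 1)).filter
    (fun S => ∀ t ∈ S.powersetCard k, t ∈ G)
  have hT : ∀ s ∈ T, s.card = k + 1 := fun s hs =>
    (Finset.mem_powersetCard.mp (Finset.mem_filter.mp hs).1).2
  have hTG : ∀ s ∈ T, ∀ v ∈ s, s.erase v ∈ G := fun s hs v hv =>
    (Finset.mem_filter.mp hs).2 _ <| Finset.mem_powersetCard.mpr
      ⟨Finset.erase_subset _ _, by simp [Finset.card_erase_of_mem hv, hT s hs]⟩
  have hbound : ((k + 1).factorial * T.card) ^ k ≤ (k.factorial * G.card) ^ (k + 1) := by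
    rcases T.card.eq_zero_or_pos with h | h
    · simp [h, Nat.one_le_iff_ne_zero.mp hk]
    · exact Nat.le_of_mul_le_mul_right
        (factorial_mul_card_pow_mul_card_le k G T hunif hT hTG) h
  have hboundR : (((k + 1).factorial : ℝ) * T.card) ^ k ≤ (k.factorial * G.card) ^ (k + 1) :=
    mod_cast hbound
  have hedges : (k.factorial : ℝ) * G.card ≤ β * n ^ k := by
    rwa [le_div_iff₀' (by positivity)] at hcard
  have hk0 : (k : ℝ) ≠ 0 := by positivity
  have hβpow : (β ^ (((k : ℝ) + 1) / k)) ^ k = β ^ (k + 1) := by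
    rw [← Real.rpow_mul_natCast hβ, div_mul_cancel₀ _ hk0]
    exact_mod_cast Real.rpow_natCast β (k + 1)
  rw [le_div_iff₀' (by positivity)]
  refine le_of_pow_le_pow_left₀ (Nat.one_le_iff_ne_zero.mp hk) (by positivity) ?_
  calc _ ≤ ((k.factorial : ℝ) * G.card) ^ (k + 1) := hboundR
    _ ≤ (β * n ^ k) ^ (k + 1) := pow_le_pow_left₀ (by positivity) hedges _
    _ = _ := by rw [mul_pow, mul_pow, hβpow]; ring
end

section
/- Fix an integer k ≥ 2. For every ρ > 0 there exist ε > 0, c > 0, and n₀ such that for all n ≥ n₀: every simple k-SAT formula G on n variables that has at least (1−ε)·C(n,k) clauses and is ρ-far from unate contains at least c·n^{v(B)} copies of some k-SAT formula B which is simple, not minimal, and uses at most 2(k+1) variables. -/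
section Blowup

open Finset

theorem card_filter_fin_cons {β : Type*} [Fintype β] {m : ℕ} (P : (Fin (m + 1) → β) → Prop)
    [DecidablePred P] :
    #{φ : Fin (m + 1) → β | P φ} = ∑ b : β, #{φ : Fin m → β | P (Fin.cons b φ)} := by
  simp only [card_filter]
  rw [← (Fin.consEquiv (fun _ : Fin (m + 1) => β)).sum_comp, Fintype.sum_prod_type]
  rfl

theorem power_mean_step {ι : Type*} [Fintype ι] {m : ℕ} {n δ : ℝ} (hn : 0 < n)
    {c : ι → ℝ} (hc : ∀ i, 0 ≤ c i) (hcard : (Fintype.card ι : ℝ) = n ^ 2)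
    (hsum : δ ^ 2 * n ^ (m + 2) ≤ ∑ i, c i) :
    δ ^ 2 ^ (m + 1) * n ^ (2 * (m + 1)) ≤ (∑ i, (c i / n ^ m) ^ 2 ^ m) * n ^ (2 * m) := by
  obtain ⟨K, hK⟩ : ∃ K, 2 ^ m = K + 1 := ⟨2 ^ m - 1, by have := Nat.one_le_two_pow (n := m); omega⟩
  have hp := pow_sum_div_card_le_sum_pow (s := (univ : Finset ι))
    (f := fun i => c i / n ^ m) (fun i _ => div_nonneg (hc i) (by positivity)) K
  rw [← sum_div, card_univ, hcard, ← hK] at hp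
  have hle : δ ^ 2 * n ^ 2 ≤ (∑ i, c i) / n ^ m := by
    rw [le_div_iff₀ (by positivity)]
    exact (le_of_eq (by ring)).trans hsum
  have hle2 : (δ ^ 2 * n ^ 2) ^ (2 ^ m) / (n ^ 2) ^ K ≤ ∑ i, (c i / n ^ m) ^ 2 ^ m :=
    le_trans (by gcongr) hp
  have heq : (δ ^ 2 * n ^ 2) ^ (2 ^ m) / (n ^ 2) ^ K = δ ^ 2 ^ (m + 1) * n ^ 2 := by
    rw [div_eq_iff (by positivity), pow_succ 2 m, mul_comm (2 ^ m) 2, pow_mul δ, hK]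
    ring
  calc δ ^ 2 ^ (m + 1) * n ^ (2 * (m + 1)) = δ ^ 2 ^ (m + 1) * n ^ 2 * n ^ (2 * m) := by ring
    _ ≤ _ := by
      rw [← heq]
      gcongr

open scoped Classical in
/-- Iterated Cauchy–Schwarz: a dense `m`-ary relation has many `2`-blowups. -/
theorem blowup_density {α : Type*} [Fintype α] [Nonempty α] (m : ℕ) :
    ∀ (P : (Fin m → α) → Prop) (δ : ℝ), 0 ≤ δ →
      δ * (Fintype.card α : ℝ) ^ m ≤ #{y : Fin m → α | P y} →
      δ ^ (2 ^ m) * (Fintype.card α : ℝ) ^ (2 * m) ≤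
        #{φ : Fin m → Bool → α | ∀ s : Fin m → Bool, P fun i => φ i (s i)} := by
  induction m with
  | zero =>
    intro P δ _ h
    simp only [pow_zero, mul_one, pow_one, mul_zero] at h ⊢
    refine h.trans (le_of_eq ?_)
    simp only [card_filter, Fintype.sum_unique, Nat.cast_inj]
    congr 2
    exact propext ⟨fun h s => by convert h, fun h => by convert h (fun i => i.elim0)⟩
  | succ m ih =>
    intro P δ hδ h
    have hn : (0 : ℝ) < Fintype.card α := by exact_mod_cast Fintype.card_pos
    set n : ℝ := (Fintype.card α : ℝ) with hn_def
    let c : (Bool → α) → ℝ := fun β => #{y : Fin m → α | ∀ b, P (Fin.cons (β b) y)}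
    let d : (Fin m → α) → ℕ := fun y => #{a : α | P (Fin.cons a y)}
    have hc : ∑ β, c β = ∑ y, (d y : ℝ) ^ 2 := by
      have hy : ∀ y, d y ^ 2 = #{β : Bool → α | ∀ b, P (Fin.cons (β b) y)} := by
        intro y
        have : #(Fintype.piFinset fun _ : Bool => ({a : α | P (Fin.cons a y)} : Finset α)) =
            d y ^ 2 := by simp [d, Fintype.card_piFinset]
        rw [← this]
        congr 1
        ext β
        simp
      have : ∑ β : Bool → α, #{y : Fin m → α | ∀ b, P (Fin.cons (β b) y)} = ∑ y, d y ^ 2 := by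
        simp only [hy, card_filter]
        exact sum_comm
      simp only [c]
      exact_mod_cast this
    have hd : (#{y : Fin (m + 1) → α | P y} : ℝ) = ∑ y, (d y : ℝ) := by
      have : #{y : Fin (m + 1) → α | P y} = ∑ y, d y := by
        rw [card_filter_fin_cons]
        simp only [d, card_filter]
        exact sum_comm
      exact_mod_cast this
    have hcs : δ ^ 2 * n ^ (m + 2) ≤ ∑ β, c β := by
      have h1 : (∑ y, (d y : ℝ)) ^ 2 ≤ n ^ m * ∑ y, (d y : ℝ) ^ 2 := by
        have := sq_sum_le_card_mul_sum_sq (s := (univ : Finset (Fin m → α)))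
          (f := fun y => (d y : ℝ))
        simpa [n] using this
      rw [hd] at h
      have h2 : (δ * n ^ (m + 1)) ^ 2 ≤ n ^ m * ∑ y, (d y : ℝ) ^ 2 :=
        (pow_le_pow_left₀ (by positivity) h 2).trans h1
      rw [hc]
      have h3 : n ^ m * (δ ^ 2 * n ^ (m + 2)) ≤ n ^ m * ∑ y, (d y : ℝ) ^ 2 := by
        refine le_trans (le_of_eq ?_) h2
        ring
      exact le_of_mul_le_mul_left h3 (by positivity)
    have hM : (#{φ : Fin (m + 1) → Bool → α | ∀ s : Fin (m + 1) → Bool,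
        P fun i => φ i (s i)} : ℝ) = ∑ β : Bool → α, (#{φ : Fin m → Bool → α |
          ∀ s : Fin m → Bool, ∀ b, P (Fin.cons (β b) fun i => φ i (s i))} : ℝ) := by
      rw [card_filter_fin_cons]
      push_cast
      refine sum_congr rfl fun β _ => ?_
      congr 2
      ext φ
      simp only [mem_filter, mem_univ, true_and]
      constructor
      · intro h s b
        convert h (Fin.cons b s) using 1
        ext i
        refine Fin.cases ?_ (fun i => ?_) i <;> simp
      · intro h s
        convert h (fun i => s i.succ) (s 0) using 1
        ext i
        refine Fin.cases ?_ (fun i => ?_) i <;> simp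
    rw [hM]
    have hβ : ∀ β, (c β / n ^ m) ^ (2 ^ m) * n ^ (2 * m) ≤ (#{φ : Fin m → Bool → α |
          ∀ s : Fin m → Bool, ∀ b, P (Fin.cons (β b) fun i => φ i (s i))} : ℝ) := by
      intro β
      have := ih (fun y => ∀ b, P (Fin.cons (β b) y)) (c β / n ^ m)
        (div_nonneg (Nat.cast_nonneg _) (pow_nonneg hn.le _))
        (by
          rw [div_mul_cancel₀ _ (pow_pos hn m).ne']
          simp only [c]
          refine le_of_eq ?_
          congr!)
      convert this
    refine le_trans ?_ (sum_le_sum fun β _ => hβ β)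
    rw [← sum_mul]
    exact power_mean_step hn (fun β => Nat.cast_nonneg _) (by simp [n]) hcs

/-- Almost all maps from a fixed finite set are injective. -/
theorem pow_mul_le_descFactorial (n k : ℕ) :
    n ^ k * n ≤ n.descFactorial k * n + k ^ 2 * n ^ k := by
  induction k with
  | zero => simp
  | succ k ih =>
    have h1 : n.descFactorial k ≤ n ^ k := Nat.descFactorial_le_pow n k
    have h2 : n * n.descFactorial k ≤ n.descFactorial (k + 1) + k * n.descFactorial k := by
      rw [Nat.descFactorial_succ, ← add_mul]
      gcongr
      omega
    have h3 : k * n.descFactorial k ≤ k * n ^ k := by gcongr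
    have h4 : n ^ (k + 1) ≤ n.descFactorial (k + 1) + (k + k ^ 2) * n ^ k := by
      rw [pow_succ]
      linarith
    calc n ^ (k + 1) * n ≤ (n.descFactorial (k + 1) + (k + k ^ 2) * n ^ k) * n := by gcongr
      _ = n.descFactorial (k + 1) * n + (k + k ^ 2) * n ^ (k + 1) := by ring
      _ ≤ _ := by gcongr; nlinarith

theorem card_injective {ι α : Type*} [Fintype ι] [DecidableEq ι] [Fintype α] [DecidableEq α]
    [DecidablePred fun f : ι → α => Function.Injective f] :
    #{f : ι → α | Function.Injective f} = (Fintype.card α).descFactorial (Fintype.card ι) := by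
  rw [← Fintype.card_embedding_eq, ← Fintype.card_subtype]
  exact Fintype.card_congr (Equiv.subtypeInjectiveEquivEmbedding ι α)

end Blowup

section PatternBlowup

open Finset

variable {ι V W : Type*}

/-- The clause with variables `y i`, `i ∈ S`, and polarities `σ i`. -/
def clauseOn [DecidableEq V] (S : Finset ι) (y : ι → V) (σ : ι → Bool) : SatClause V :=
  S.image fun i => (y i, σ i)

theorem clauseVars_clauseOn [DecidableEq V] (S : Finset ι) (y : ι → V) (σ : ι → Bool) :
    clauseVars (clauseOn S y σ) = S.image y := by
  simp only [clauseVars, clauseOn, image_image]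
  rfl

theorem isKClause_clauseOn [DecidableEq V] {S : Finset ι} {y : ι → V} (hy : Function.Injective y)
    (σ : ι → Bool) : IsKClause #S (clauseOn S y σ) := by
  refine ⟨card_image_of_injective _ fun i j h => hy (Prod.ext_iff.1 h).1, ?_⟩
  rw [clauseVars_clauseOn, card_image_of_injective _ hy]

theorem image_clauseOn [DecidableEq V] [DecidableEq W] (φ : W → V) (S : Finset ι) (y : ι → W)
    (σ : ι → Bool) :
    (clauseOn S y σ).image (fun l => (φ l.1, l.2)) = clauseOn S (fun i => φ (y i)) σ := by
  simp only [clauseOn, image_image]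
  rfl

theorem satisfiesClause_clauseOn [DecidableEq V] {S : Finset ι} {y : ι → V} {σ : ι → Bool}
    {w : V → Bool} : SatisfiesClause w (clauseOn S y σ) ↔ ∀ i ∈ S, w (y i) = σ i := by
  simp [SatisfiesClause, clauseOn]

theorem choice_injective (e : ι × Bool ≃ W) (s : ι → Bool) :
    Function.Injective fun i => e (i, s i) :=
  fun _ _ h => (Prod.ext_iff.1 (e.injective h)).1

variable [Fintype ι] [DecidableEq ι] [DecidableEq V] [DecidableEq W]

/-- A pair `(r, σ)` in `T` encodes the clause on all indices but `r` with polarities `σ`;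
this is the `2`-blowup of the formula encoded by `T`. -/
def patternBlowup (e : ι × Bool ≃ W) (T : Finset (ι × (ι → Bool))) : SatFormula W :=
  (T ×ˢ (univ : Finset (ι → Bool))).image
    fun p => clauseOn (univ.erase p.1.1) (fun i => e (i, p.2 i)) p.1.2

variable {e : ι × Bool ≃ W} {T : Finset (ι × (ι → Bool))}

theorem mem_patternBlowup {C : SatClause W} :
    C ∈ patternBlowup e T ↔ ∃ p ∈ T, ∃ s : ι → Bool,
      clauseOn (univ.erase p.1) (fun i => e (i, s i)) p.2 = C := by
  simp only [patternBlowup, mem_image, mem_product, mem_univ, and_true, Prod.exists]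
  constructor
  · rintro ⟨r, σ, s, h, rfl⟩
    exact ⟨r, σ, h, s, rfl⟩
  · rintro ⟨r, σ, h, s, rfl⟩
    exact ⟨r, σ, s, h, rfl⟩

theorem mem_image_choice {r i : ι} {b : Bool} {s : ι → Bool} :
    e (i, b) ∈ (univ.erase r).image (fun i => e (i, s i)) ↔ i ≠ r ∧ b = s i := by
  simp only [mem_image, mem_erase, mem_univ, and_true, EmbeddingLike.apply_eq_iff_eq,
    Prod.mk.injEq]
  constructor
  · rintro ⟨j, hj, rfl, rfl⟩
    exact ⟨hj, rfl⟩
  · rintro ⟨hi, rfl⟩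
    exact ⟨i, hi, rfl, rfl⟩

theorem isKFormula_patternBlowup {k : ℕ} (hk : Fintype.card ι = k + 1) :
    IsKFormula k (patternBlowup e T) := by
  intro C hC
  obtain ⟨p, -, s, rfl⟩ := mem_patternBlowup.1 hC
  have := isKClause_clauseOn (S := univ.erase p.1) (choice_injective e s) p.2
  rwa [card_erase_of_mem (mem_univ _), card_univ, hk, Nat.add_sub_cancel] at this

theorem simpleFormula_patternBlowup (hT : ∀ p ∈ T, ∀ q ∈ T, p.1 = q.1 → p = q) :
    SimpleFormula (patternBlowup e T) := by
  intro C hC C' hC' h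
  obtain ⟨p, hp, s, rfl⟩ := mem_patternBlowup.1 hC
  obtain ⟨q, hq, t, rfl⟩ := mem_patternBlowup.1 hC'
  rw [clauseVars_clauseOn, clauseVars_clauseOn] at h
  have key : ∀ i b, (i ≠ p.1 ∧ b = s i) ↔ (i ≠ q.1 ∧ b = t i) := fun i b => by
    rw [← mem_image_choice (e := e), h, mem_image_choice]
  have hpq : p.1 = q.1 := by
    by_contra hne
    exact ((key q.1 (s q.1)).1 ⟨Ne.symm hne, rfl⟩).1 rfl
  obtain rfl := hT p hp q hq hpq
  refine image_congr fun i hi => ?_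
  have hi' : i ≠ p.1 := by simpa using hi
  simp only [((key i (s i)).1 ⟨hi', rfl⟩).2]

theorem not_minimalFormula_patternBlowup {r p q : ι} {τ σ₁ σ₂ : ι → Bool} (hrp : r ≠ p)
    (hrq : r ≠ q) (h₁ : σ₁ r = true) (h₂ : σ₂ r = false) (hr : (r, τ) ∈ T) (hp : (p, σ₁) ∈ T)
    (hq : (q, σ₂) ∈ T) : ¬ MinimalFormula (patternBlowup e T) := by
  intro hmin
  obtain ⟨w, hw, huniq⟩ := hmin _ (mem_patternBlowup.2 ⟨_, hr, fun _ => true, rfl⟩)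
  rw [satisfiesClause_clauseOn] at hw
  have hvars : ∀ p ∈ T, ∀ s : ι → Bool, (∀ i, i ≠ p.1 → w (e (i, s i)) = p.2 i) →
      ∀ i b, (i ≠ p.1 ∧ b = s i) ↔ (i ≠ r ∧ b = true) := by
    intro p hp s hs i b
    have := huniq _ (mem_patternBlowup.2 ⟨p, hp, s, rfl⟩)
      (satisfiesClause_clauseOn.2 fun i hi => hs i (ne_of_mem_erase hi))
    have h := congrArg clauseVars this
    rw [clauseVars_clauseOn, clauseVars_clauseOn] at h
    rw [← mem_image_choice (e := e), h, mem_image_choice]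
  have hfalse : ∀ i, i ≠ r → w (e (i, false)) ≠ τ i := by
    intro i hi hwi
    have := hvars _ hr (Function.update (fun _ => true) i false) (fun j hj => by
      by_cases hji : j = i
      · subst hji; simpa using hwi
      · simpa [hji] using hw j (by simpa using hj)) i false
    simp [hi] at this
  have hboth : ∀ i, i ≠ r → ∀ b, ∃ c, w (e (i, c)) = b := by
    intro i hi b
    have ht : w (e (i, true)) = τ i := hw i (by simpa using hi)
    by_cases hb : τ i = b
    · exact ⟨true, ht.trans hb⟩
    · refine ⟨false, ?_⟩
      have := hfalse i hi
      revert this hb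
      cases w (e (i, false)) <;> cases τ i <;> cases b <;> simp
  have hopp : ∀ p σ, r ≠ p → (p, σ) ∈ T → w (e (r, true)) ≠ σ r := by
    intro p σ hne hp hwr
    choose! s hs using fun i (hi : i ≠ r) => hboth i hi (σ i)
    have := hvars _ hp (Function.update s r true) (fun j _ => by
      by_cases hj : j = r
      · subst hj; simpa using hwr
      · simpa [hj] using hs j hj) r true
    simp [hne] at this
  have a := hopp p σ₁ hrp hp
  have b := hopp q σ₂ hrq hq
  rw [h₁] at a
  rw [h₂] at b
  exact b (by simpa using a)

theorem formulaVars_patternBlowup [Fintype W] {p q : ι × (ι → Bool)} (hp : p ∈ T) (hq : q ∈ T)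
    (hpq : p.1 ≠ q.1) : formulaVars (patternBlowup e T) = univ := by
  refine eq_univ_of_forall fun x => ?_
  obtain ⟨⟨i, b⟩, rfl⟩ := e.surjective x
  obtain ⟨p', hp', hi⟩ : ∃ p' ∈ T, i ≠ p'.1 := by
    by_cases h : i = p.1
    · exact ⟨q, hq, h ▸ hpq⟩
    · exact ⟨p, hp, h⟩
  refine mem_biUnion.2 ⟨_, mem_patternBlowup.2 ⟨p', hp', fun _ => b, rfl⟩, ?_⟩
  rw [clauseVars_clauseOn, mem_image_choice]
  exact ⟨hi, rfl⟩

theorem formulaVars_mapFormula (φ : W → V) (F : SatFormula W) :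
    formulaVars (mapFormula φ F) = (formulaVars F).image φ := by
  ext x
  simp only [formulaVars, mapFormula, clauseVars, mem_biUnion, mem_image]
  constructor
  · rintro ⟨_, ⟨C, hC, rfl⟩, l, hl, rfl⟩
    obtain ⟨l', hl', rfl⟩ := mem_image.1 hl
    exact ⟨_, ⟨C, hC, l', hl', rfl⟩, rfl⟩
  · rintro ⟨_, ⟨C, hC, l', hl', rfl⟩, rfl⟩
    exact ⟨_, ⟨C, hC, rfl⟩, _, mem_image_of_mem _ hl', rfl⟩

open scoped Classical in
theorem card_embeddings_le_copyCount [Fintype V] [Fintype W] {F : SatFormula W}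
    (hF : formulaVars F = univ) (G : SatFormula V) :
    #{φ : W → V | Function.Injective φ ∧ mapFormula φ F ⊆ G} ≤
      Fintype.card W ^ Fintype.card W * copyCount F G := by
  have hcopy : copyCount F G = #{G' : SatFormula V | G' ⊆ G ∧ IsCopyOf F G'} := by
    rw [copyCount, ← Set.ncard_coe_finset]
    congr 1
    ext
    simp
  rw [hcopy]
  refine card_le_mul_card_image_of_maps_to (f := fun φ => mapFormula φ F) ?_ _ ?_
  · intro φ hφ
    simp only [mem_filter, mem_univ, true_and] at hφ ⊢
    exact ⟨hφ.2, φ, hφ.1.injOn, rfl⟩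
  · intro G' hG'
    obtain ⟨-, φ₀, -, hφ₀⟩ := (mem_filter.1 hG').2
    have hvars : ∀ φ : W → V, mapFormula φ F = G' → univ.image φ = formulaVars G' := by
      rintro φ rfl
      rw [formulaVars_mapFormula, hF]
    have hcard : #(formulaVars G') ≤ Fintype.card W := by
      rw [← hvars φ₀ hφ₀.symm]
      exact card_image_le
    calc _ ≤ #(Fintype.piFinset fun _ : W => formulaVars G') := by
          refine card_le_card fun φ hφ => ?_
          rw [Fintype.mem_piFinset]
          intro x
          rw [← hvars φ (mem_filter.1 hφ).2]
          exact mem_image_of_mem _ (mem_univ x)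
      _ = #(formulaVars G') ^ Fintype.card W := by simp [Fintype.card_piFinset]
      _ ≤ _ := Nat.pow_le_pow_left hcard _

open scoped Classical in
theorem card_blowups_le [Fintype V] [Fintype W] (hF : formulaVars (patternBlowup e T) = univ)
    (G : SatFormula V) :
    #{Φ : ι → Bool → V | ∀ s : ι → Bool, ∀ p ∈ T,
        clauseOn (univ.erase p.1) (fun i => Φ i (s i)) p.2 ∈ G} ≤
      Fintype.card W ^ Fintype.card W * copyCount (patternBlowup e T) G +
        #{φ : W → V | ¬ Function.Injective φ} := by
  refine le_trans ?_ (Nat.add_le_add_right (card_embeddings_le_copyCount hF G) _)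
  refine le_trans ?_ (card_union_le _ _)
  refine card_le_card_of_injOn (fun Φ x => Φ (e.symm x).1 (e.symm x).2) ?_ ?_
  · intro Φ hΦ
    simp only [coe_filter, mem_univ, true_and, Set.mem_ofPred_eq] at hΦ
    simp only [coe_union, coe_filter, mem_univ, true_and, Set.mem_union, Set.mem_ofPred_eq]
    refine (em _).imp_left fun h => ⟨h, ?_⟩
    intro C hC
    obtain ⟨C', hC', rfl⟩ := mem_image.1 hC
    obtain ⟨p, hp, s, rfl⟩ := mem_patternBlowup.1 hC'
    refine Eq.mpr (congrArg (· ∈ G) (image_clauseOn (fun x => Φ (e.symm x).1 (e.symm x).2)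
      (univ.erase p.1) (fun i => e (i, s i)) p.2)) ?_
    simpa only [Equiv.symm_apply_apply] using hΦ s p hp
  · intro Φ _ Φ' _ h
    ext i b
    simpa using congrFun h (e (i, b))

end PatternBlowup

section Density

open Finset

variable {V : Type*} [DecidableEq V]

theorem IsKClause.polarity_unique {k : ℕ} {C : SatClause V} (hC : IsKClause k C) {x : V}
    {b b' : Bool} (h : (x, b) ∈ C) (h' : (x, b') ∈ C) : b = b' := by
  have hinj : Set.InjOn Prod.fst (C : Set (V × Bool)) :=
    card_image_iff.1 (hC.2.trans hC.1.symm)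
  exact (Prod.ext_iff.1 (hinj h h' rfl)).2

theorem IsKClause.exists_clauseOn_eq {ι : Type*} [Fintype ι] {k : ℕ} {C : SatClause V}
    (hC : IsKClause k C) {z : ι → V} (hz : univ.image z = clauseVars C) :
    ∃ σ : ι → Bool, clauseOn univ z σ = C := by
  have h : ∀ i, ∃ b, (z i, b) ∈ C := by
    intro i
    have : z i ∈ clauseVars C := hz ▸ mem_image_of_mem z (mem_univ i)
    obtain ⟨⟨v, b⟩, hl, hv⟩ := mem_image.1 this
    exact ⟨b, by rw [← hv]; exact hl⟩
  choose σ hσ using h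
  refine ⟨σ, Subset.antisymm ?_ ?_⟩
  · intro l hl
    obtain ⟨i, -, rfl⟩ := mem_image.1 hl
    exact hσ i
  · rintro ⟨v, b⟩ hl
    have : v ∈ univ.image z := hz ▸ mem_image_of_mem Prod.fst hl
    obtain ⟨i, -, rfl⟩ := mem_image.1 this
    rw [hC.polarity_unique hl (hσ i)]
    exact mem_image_of_mem _ (mem_univ i)

theorem exists_enumeration {k : ℕ} (S : Finset V) (hS : #S = k) :
    ∃ g : Fin k → V, Function.Injective g ∧ univ.image g = S := by
  let f := S.equivFinOfCardEq hS
  refine ⟨fun i => f.symm i, Subtype.val_injective.comp f.symm.injective, ?_⟩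
  ext v
  simp only [mem_image, mem_univ, true_and]
  constructor
  · rintro ⟨i, rfl⟩
    exact (f.symm i).2
  · intro hv
    exact ⟨f ⟨v, hv⟩, by simp⟩

/-- The tuple `z` enumerates the variables of a clause of `G`. -/
def Covered {k : ℕ} (G : SatFormula V) (z : Fin k → V) : Prop :=
  ∃ σ : Fin k → Bool, clauseOn univ z σ ∈ G

/-- The variables `x, t 0, …, t (m - 1)` support a clause of `G` in which `x` has polarity `b`. -/
def Polar {m : ℕ} (G : SatFormula V) (b : Bool) (x : V) (t : Fin m → V) : Prop :=
  ∃ σ : Fin (m + 1) → Bool, σ 0 = b ∧ clauseOn univ (Fin.cons x t) σ ∈ G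

theorem covered_cons_iff {m : ℕ} {G : SatFormula V} {x : V} {t : Fin m → V} :
    Covered G (Fin.cons x t : Fin (m + 1) → V) ↔ Polar G true x t ∨ Polar G false x t := by
  constructor
  · rintro ⟨σ, hσ⟩
    cases h : σ 0
    · exact Or.inr ⟨σ, h, hσ⟩
    · exact Or.inl ⟨σ, h, hσ⟩
  · rintro (⟨σ, -, hσ⟩ | ⟨σ, -, hσ⟩) <;> exact ⟨σ, hσ⟩

variable [Fintype V] {G : SatFormula V}

open scoped Classical in
theorem factorial_mul_card_le [Nonempty V] {k : ℕ} (hG : IsKFormula k G) (hS : SimpleFormula G) :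
    k.factorial * #G ≤ #{z : Fin k → V | Covered G z} := by
  choose! g hg hgS using fun C (hC : C ∈ G) => exists_enumeration (clauseVars C) (hG C hC).2
  have himg : ∀ C ∈ G, ∀ π : Equiv.Perm (Fin k),
      univ.image (fun i => g C (π i)) = clauseVars C := by
    intro C hC π
    rw [← hgS C hC]
    ext v
    simp only [mem_image, mem_univ, true_and]
    exact ⟨fun ⟨i, hi⟩ => ⟨π i, hi⟩, fun ⟨i, hi⟩ => ⟨π.symm i, by simpa using hi⟩⟩
  have hcard : k.factorial * #G = #((univ : Finset (Equiv.Perm (Fin k))) ×ˢ G) := by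
    rw [card_product, card_univ, Fintype.card_perm, Fintype.card_fin]
  rw [hcard]
  refine card_le_card_of_injOn (fun p i => g p.2 (p.1 i)) ?_ ?_
  · rintro ⟨π, C⟩ hp
    have hC : C ∈ G := (mem_product.1 hp).2
    obtain ⟨σ, hσ⟩ := (hG C hC).exists_clauseOn_eq (himg C hC π)
    exact mem_filter.2 ⟨mem_univ _, σ, hσ.symm.subst (motive := (· ∈ G)) hC⟩
  · rintro ⟨π, C⟩ hp ⟨π', C'⟩ hp' h
    have hC : C ∈ G := (mem_product.1 hp).2
    have hC' : C' ∈ G := (mem_product.1 hp').2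
    have hCC : C = C' := hS C hC C' hC' (by
      rw [← himg C hC π, ← himg C' hC' π']
      exact congrArg (fun z : Fin k → V => univ.image z) h)
    subst hCC
    refine Prod.ext (Equiv.ext fun i => hg C hC (congrFun h i)) rfl

open scoped Classical in
theorem card_not_covered_le [Nonempty V] {k : ℕ} (hG : IsKFormula k G) (hS : SimpleFormula G)
    {ε : ℝ} (hε : 0 ≤ ε) (hcard : (1 - ε) * ((Fintype.card V).choose k : ℝ) ≤ #G) :
    (#{z : Fin k → V | ¬ Covered G z} : ℝ) ≤
      (ε + (k : ℝ) ^ 2 / Fintype.card V) * (Fintype.card V : ℝ) ^ k := by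
  have hn : (0 : ℝ) < Fintype.card V := by exact_mod_cast Fintype.card_pos
  have h1 : (#{z : Fin k → V | Covered G z} : ℝ) + #{z : Fin k → V | ¬ Covered G z} =
      (Fintype.card V : ℝ) ^ k := by
    have := card_filter_add_card_filter_not (s := (univ : Finset (Fin k → V))) (Covered G)
    rw [card_univ, Fintype.card_fun, Fintype.card_fin] at this
    exact_mod_cast this
  have h2 : (k.factorial : ℝ) * #G ≤ #{z : Fin k → V | Covered G z} := by
    exact_mod_cast factorial_mul_card_le hG hS
  have h3 : ((Fintype.card V).descFactorial k : ℝ) =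
      k.factorial * ((Fintype.card V).choose k : ℝ) := by
    exact_mod_cast Nat.descFactorial_eq_factorial_mul_choose _ _
  have h4 : ((Fintype.card V).descFactorial k : ℝ) ≤ (Fintype.card V : ℝ) ^ k := by
    exact_mod_cast Nat.descFactorial_le_pow _ _
  have h5 : (Fintype.card V : ℝ) ^ k * Fintype.card V ≤
      (Fintype.card V).descFactorial k * Fintype.card V +
        (k : ℝ) ^ 2 * (Fintype.card V : ℝ) ^ k := by
    exact_mod_cast pow_mul_le_descFactorial (Fintype.card V) k
  set n : ℝ := (Fintype.card V : ℝ) with hn_def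
  have h6 : n ^ k ≤ (Fintype.card V).descFactorial k + (k : ℝ) ^ 2 / n * n ^ k := by
    refine le_of_mul_le_mul_right (h5.trans (le_of_eq ?_)) hn
    field_simp
  have h7 : (1 - ε) * ((Fintype.card V).descFactorial k : ℝ) ≤ k.factorial * #G := by
    rw [h3]
    calc _ = (k.factorial : ℝ) * ((1 - ε) * ((Fintype.card V).choose k : ℝ)) := by ring
      _ ≤ _ := by gcongr
  nlinarith [mul_le_mul_of_nonneg_left h4 hε]

open scoped Classical in
theorem card_clauses_le_card_polar {m : ℕ} (hG : IsKFormula (m + 1) G) (hS : SimpleFormula G)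
    (x : V) (b : Bool) :
    #{C ∈ G | (x, b) ∈ C} ≤ #{t : Fin m → V | Polar G b x t} := by
  have h : ∀ C, C ∈ G → (x, b) ∈ C → ∃ t : Fin m → V,
      univ.image (Fin.cons x t : Fin (m + 1) → V) = clauseVars C := by
    intro C hC hx
    have hxC : x ∈ clauseVars C := mem_image_of_mem Prod.fst hx
    obtain ⟨t, -, ht⟩ := exists_enumeration (k := m) ((clauseVars C).erase x)
      (by rw [card_erase_of_mem hxC, (hG C hC).2, Nat.add_sub_cancel])
    refine ⟨t, ?_⟩
    rw [← insert_erase hxC, ← ht]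
    ext v
    simp [Fin.exists_fin_succ, eq_comm]
  have : Nonempty V := ⟨x⟩
  choose! t ht using h
  refine card_le_card_of_injOn t ?_ ?_
  · intro C hC
    obtain ⟨hC, hx⟩ := mem_filter.1 hC
    obtain ⟨σ, hσ⟩ := (hG C hC).exists_clauseOn_eq (ht C hC hx)
    refine mem_filter.2 ⟨mem_univ _, σ, (hG C hC).polarity_unique (x := x) ?_ hx, hσ.symm.subst (motive := (· ∈ G)) hC⟩
    rw [← hσ]
    exact mem_image.2 ⟨0, mem_univ _, rfl⟩
  · intro C hC C' hC' h
    obtain ⟨hC, hx⟩ := mem_filter.1 hC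
    obtain ⟨hC', hx'⟩ := mem_filter.1 hC'
    exact hS C hC C' hC' (by rw [← ht C hC hx, ← ht C' hC' hx', h])

open scoped Classical in
theorem lt_sum_min_polar {m : ℕ} (hG : IsKFormula (m + 1) G) (hS : SimpleFormula G) {r : ℝ}
    (hfar : ¬ ∃ D ⊆ G, (#D : ℝ) ≤ r ∧ UnateFormula (G \ D)) :
    r < ∑ x : V, (min #{t : Fin m → V | Polar G true x t}
      #{t : Fin m → V | Polar G false x t} : ℕ) := by
  by_contra! hle
  choose b hb using fun x : V => show ∃ b : Bool, #{C ∈ G | (x, b) ∈ C} ≤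
      min #{t : Fin m → V | Polar G true x t} #{t : Fin m → V | Polar G false x t} by
    rcases le_total #{t : Fin m → V | Polar G true x t} #{t : Fin m → V | Polar G false x t}
      with h | h
    · exact ⟨true, by rw [min_eq_left h]; exact card_clauses_le_card_polar hG hS x true⟩
    · exact ⟨false, by rw [min_eq_right h]; exact card_clauses_le_card_polar hG hS x false⟩
  refine hfar ⟨univ.biUnion fun x => {C ∈ G | (x, b x) ∈ C}, ?_, ?_, ?_⟩
  · exact biUnion_subset.2 fun x _ => filter_subset _ _
  · refine le_trans ?_ hle
    exact_mod_cast card_biUnion_le.trans (sum_le_sum fun x _ => hb x)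
  · intro x ⟨⟨C, hC, hx⟩, ⟨C', hC', hx'⟩⟩
    have key : ∀ C ∈ G \ univ.biUnion fun x => {C ∈ G | (x, b x) ∈ C}, (x, b x) ∉ C := by
      intro C hC h
      obtain ⟨h1, h2⟩ := mem_sdiff.1 hC
      exact h2 (mem_biUnion.2 ⟨x, mem_univ x, mem_filter.2 ⟨h1, h⟩⟩)
    cases hbx : b x
    · exact key C' hC' (hbx ▸ hx')
    · exact key C hC (hbx ▸ hx)

open scoped Classical in
theorem sq_le_sum_polar_mul_polar {m : ℕ} (hG : IsKFormula (m + 1) G) (hS : SimpleFormula G)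
    {r : ℝ} (hr : 0 ≤ r) (hfar : ¬ ∃ D ⊆ G, (#D : ℝ) ≤ r ∧ UnateFormula (G \ D)) :
    r ^ 2 ≤ Fintype.card V * ∑ x : V, (#{t : Fin m → V | Polar G true x t} : ℝ) *
      #{t : Fin m → V | Polar G false x t} := by
  have h := (lt_sum_min_polar hG hS hfar).le
  have h2 := sq_sum_le_card_mul_sum_sq (s := (univ : Finset V)) (f := fun x =>
    ((min #{t : Fin m → V | Polar G true x t} #{t : Fin m → V | Polar G false x t} : ℕ) : ℝ))
  push_cast at h h2
  refine ((pow_le_pow_left₀ hr h 2).trans h2).trans ?_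
  rw [card_univ]
  refine mul_le_mul_of_nonneg_left (sum_le_sum fun x _ => ?_) (Nat.cast_nonneg _)
  rw [sq]
  exact mul_le_mul (min_le_left _ _) (min_le_right _ _) (by positivity) (by positivity)

end Density

section Path

open Finset

variable {V : Type*} {m : ℕ}

/-- The tuple agreeing with `b` in its first `j` entries and with `a` afterwards. -/
def hybrid (j : ℕ) (a b : Fin m → V) : Fin m → V := fun i => if (i : ℕ) < j then b i else a i

theorem hybrid_zero (a b : Fin m → V) : hybrid 0 a b = a := by
  ext i
  simp [hybrid]

theorem hybrid_length (a b : Fin m → V) : hybrid m a b = b := by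
  ext i
  simp [hybrid]

theorem hybrid_succ (j : Fin m) (a b : Fin m → V) :
    hybrid (j + 1) a b = Function.update (hybrid j a b) j (hybrid j b a j) := by
  ext i
  by_cases h : i = j
  · subst h
    simp [hybrid]
  · have : (i : ℕ) ≠ j := fun h' => h (Fin.ext h')
    have h2 : (i : ℕ) < j + 1 ↔ (i : ℕ) < j := by omega
    simp [hybrid, h, h2]

theorem hybrid_pair_injective (j : ℕ) :
    Function.Injective fun p : (Fin m → V) × (Fin m → V) => (hybrid j p.1 p.2, hybrid j p.2 p.1) := by
  rintro ⟨a, b⟩ ⟨a', b'⟩ h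
  obtain ⟨h1, h2⟩ := Prod.ext_iff.1 h
  have key : ∀ i, a i = a' i ∧ b i = b' i := by
    intro i
    have h1 := congrFun h1 i
    have h2 := congrFun h2 i
    simp only [hybrid] at h1 h2
    split_ifs at h1 h2
    · exact ⟨h2, h1⟩
    · exact ⟨h1, h2⟩
  exact Prod.ext (funext fun i => (key i).1) (funext fun i => (key i).2)

theorem exists_hybrid_step (hm : 0 < m) {A B : (Fin m → V) → Prop} {a b : Fin m → V} (ha : A a)
    (hb : B b) :
    (∃ j : Fin m, A (hybrid j a b) ∧ B (hybrid (j + 1) a b)) ∨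
      ∃ j ∈ Finset.range (m + 1), ¬ (A (hybrid j a b) ∨ B (hybrid j a b)) := by
  by_contra! h
  obtain ⟨h1, h2⟩ := h
  have hA : ∀ j, j < m → A (hybrid j a b) := by
    intro j
    induction j with
    | zero => intro _; rwa [hybrid_zero]
    | succ j ih =>
      intro hj
      by_contra hn
      exact h1 ⟨j, by omega⟩ (ih (by omega)) 
        ((h2 (j + 1) (Finset.mem_range.2 (by omega))).resolve_left hn)
  refine h1 ⟨m - 1, by omega⟩ (hA (m - 1) (by omega)) ?_
  have : m - 1 + 1 = m := by omega
  simp only [this, hybrid_length]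
  exact hb

variable [Fintype V]

open scoped Classical in
theorem card_step_mul_le (A B : (Fin m → V) → Prop) (j : Fin m) :
    #{p : (Fin m → V) × (Fin m → V) | A p.1 ∧ B (Function.update p.1 j (p.2 j))} *
        Fintype.card V ≤
      #{p : (Fin m → V) × V | A p.1 ∧ B (Function.update p.1 j p.2)} * Fintype.card V ^ m := by
  have hm : Fintype.card V ^ m = #(univ : Finset (Fin m → V)) := by simp
  rw [hm, ← card_univ (α := V), ← card_product, ← card_product]
  refine card_le_card_of_injOn
    (fun q => ((q.1.1, q.1.2 j), Function.update q.1.2 j q.2)) ?_ ?_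
  · intro q hq
    simpa using hq
  · rintro ⟨⟨t, c⟩, u⟩ - ⟨⟨t', c'⟩, u'⟩ - h
    simp only [Prod.mk.injEq] at h ⊢
    obtain ⟨⟨ht, hc⟩, hu⟩ := h
    refine ⟨⟨ht, ?_⟩, by simpa using congrFun hu j⟩
    ext i
    by_cases hi : i = j
    · rw [hi, hc]
    · simpa [hi] using congrFun hu i

open scoped Classical in
/-- Walking from `A` to `B` by changing one coordinate at a time. -/
theorem card_mul_card_le (hm : 0 < m) (A B : (Fin m → V) → Prop) :
    #{a | A a} * #{b | B b} * Fintype.card V ≤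
      (∑ j : Fin m, #{p : (Fin m → V) × V | A p.1 ∧ B (Function.update p.1 j p.2)} *
        Fintype.card V ^ m) +
      (m + 1) * (#{t | ¬ (A t ∨ B t)} * Fintype.card V ^ (m + 1)) := by
  have h1 : #{a | A a} * #{b | B b} ≤
      (∑ j : Fin m,
        #{p : (Fin m → V) × (Fin m → V) | A p.1 ∧ B (Function.update p.1 j (p.2 j))}) +
      (m + 1) * (#{t | ¬ (A t ∨ B t)} * Fintype.card V ^ m) := by
    rw [← card_product]
    have hsub : ({a | A a} : Finset (Fin m → V)) ×ˢ ({b | B b} : Finset (Fin m → V)) ⊆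
        (univ.biUnion fun j : Fin m => {p | A (hybrid j p.1 p.2) ∧ B (hybrid (j + 1) p.1 p.2)}) ∪
        ((Finset.range (m + 1)).biUnion fun j =>
          {p | ¬ (A (hybrid j p.1 p.2) ∨ B (hybrid j p.1 p.2))}) := by
      intro p hp
      simp only [mem_product, mem_filter, mem_univ, true_and] at hp
      simp only [mem_union, mem_biUnion, mem_filter, mem_univ, true_and]
      exact exists_hybrid_step hm hp.1 hp.2
    refine (card_le_card hsub).trans ((card_union_le _ _).trans (Nat.add_le_add ?_ ?_))
    · refine card_biUnion_le.trans (sum_le_sum fun j _ => ?_)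
      refine card_le_card_of_injOn _ ?_ (hybrid_pair_injective (j : ℕ)).injOn
      intro p hp
      simp only [coe_filter, mem_univ, true_and, Set.mem_ofPred_eq, hybrid_succ] at hp ⊢
      exact hp
    · refine card_biUnion_le.trans ?_
      refine (sum_le_card_nsmul _ _ (#{t | ¬ (A t ∨ B t)} * Fintype.card V ^ m)
        fun j _ => ?_).trans (by simp)
      have hm : Fintype.card V ^ m = #(univ : Finset (Fin m → V)) := by simp
      rw [hm, ← card_product]
      refine card_le_card_of_injOn _ ?_ (hybrid_pair_injective j).injOn
      intro p hp
      simpa using hp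
  calc _ ≤ _ := Nat.mul_le_mul_right (Fintype.card V) h1
    _ = (∑ j : Fin m,
        #{p : (Fin m → V) × (Fin m → V) | A p.1 ∧ B (Function.update p.1 j (p.2 j))} *
          Fintype.card V) +
        (m + 1) * (#{t | ¬ (A t ∨ B t)} * Fintype.card V ^ (m + 1)) := by
      rw [add_mul, sum_mul]
      ring
    _ ≤ _ := Nat.add_le_add_right (sum_le_sum fun j _ => card_step_mul_le A B j) _

end Path

section Pattern

open Finset

variable {V : Type*} [DecidableEq V] {m : ℕ} {G : SatFormula V}

theorem exists_clauseOn_erase {f : Fin (m + 1) → Fin (m + 2)} (hf : Function.Injective f)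
    {r : Fin (m + 2)} (hr : ∀ i, f i ≠ r) {y : Fin (m + 2) → V} {z : Fin (m + 1) → V}
    (hz : ∀ i, y (f i) = z i) (σ : Fin (m + 1) → Bool) :
    ∃ σ' : Fin (m + 2) → Bool, (∀ i, σ' (f i) = σ i) ∧
      clauseOn (univ.erase r) y σ' = clauseOn univ z σ := by
  obtain ⟨σ', hσ'⟩ := hf.surjective_comp_right (γ := Bool) σ
  have hσ : ∀ i, σ' (f i) = σ i := congrFun hσ'
  refine ⟨σ', hσ, ?_⟩
  have himg : univ.image f = univ.erase r := by
    refine eq_of_subset_of_card_le ?_ ?_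
    · intro i hi
      obtain ⟨a, -, rfl⟩ := mem_image.1 hi
      exact mem_erase.2 ⟨hr a, mem_univ _⟩
    · rw [card_image_of_injective _ hf, card_erase_of_mem (mem_univ _)]
      simp
  rw [← himg]
  simp only [clauseOn, image_image]
  exact image_congr fun i _ => by simp [hz, hσ]

/-- Three clauses on `m + 2` variables, omitting the variables `0`, `1` and `j + 2`. -/
def stepPattern (j : Fin m) (τ σ₁ σ₂ : Fin (m + 2) → Bool) :
    Finset (Fin (m + 2) × (Fin (m + 2) → Bool)) :=
  {(0, τ), (1, σ₁), (j.succ.succ, σ₂)}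

theorem exists_stepPattern {x v : V} {t : Fin m → V} {j : Fin m} (hA : Polar G true x t)
    (hB : Polar G false x (Function.update t j v)) (hC : Covered G (Fin.cons v t : Fin (m + 1) → V)) :
    ∃ τ σ₁ σ₂ : Fin (m + 2) → Bool, σ₁ 0 = true ∧ σ₂ 0 = false ∧
      ∀ p ∈ stepPattern j τ σ₁ σ₂, clauseOn (univ.erase p.1)
        (Fin.cons x (Fin.cons v t : Fin (m + 1) → V) : Fin (m + 2) → V) p.2 ∈ G := by
  obtain ⟨τ, hτ⟩ := hC
  obtain ⟨σ₁, h1, hσ₁⟩ := hA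
  obtain ⟨σ₂, h2, hσ₂⟩ := hB
  have inj0 : Function.Injective (Fin.succ : Fin (m + 1) → Fin (m + 2)) := Fin.succ_injective _
  have inj1 : Function.Injective (Fin.cons 0 (fun i => i.succ.succ) : Fin (m + 1) → Fin (m + 2)) := by
    rw [Fin.cons_injective_iff]
    refine ⟨?_, (Fin.succ_injective _).comp (Fin.succ_injective _)⟩
    rintro ⟨i, hi⟩
    exact Fin.succ_ne_zero _ hi
  have inj2 : Function.Injective (Fin.cons 0 (fun i => if i = j then 1 else i.succ.succ) :
      Fin (m + 1) → Fin (m + 2)) := by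
    rw [Fin.cons_injective_iff]
    constructor
    · rintro ⟨i, hi⟩
      dsimp only at hi
      split_ifs at hi
      · exact absurd hi (by simp)
      · exact Fin.succ_ne_zero _ hi
    · intro a b hab
      dsimp only at hab
      split_ifs at hab with ha hb hb
      · rw [ha, hb]
      · exact absurd hab.symm (by rw [← Fin.succ_zero_eq_one]; simp [Fin.ext_iff])
      · exact absurd hab (by rw [← Fin.succ_zero_eq_one]; simp [Fin.ext_iff])
      · simpa using hab
  obtain ⟨τ', -, hτ'⟩ := exists_clauseOn_erase inj0 (r := 0) (fun i => Fin.succ_ne_zero i)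
    (y := Fin.cons x (Fin.cons v t : Fin (m + 1) → V)) (fun i => by rw [Fin.cons_succ]) τ
  obtain ⟨σ₁', h1', hσ₁'⟩ := exists_clauseOn_erase inj1 (r := 1)
    (fun i => by refine Fin.cases ?_ (fun i => ?_) i <;> simp [Fin.ext_iff])
    (y := Fin.cons x (Fin.cons v t : Fin (m + 1) → V)) (z := Fin.cons x t)
    (fun i => by refine Fin.cases ?_ (fun i => ?_) i <;> simp) σ₁
  obtain ⟨σ₂', h2', hσ₂'⟩ := exists_clauseOn_erase inj2 (r := j.succ.succ)
    (fun i => by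
      refine Fin.cases ?_ (fun i => ?_) i
      · simp [Fin.ext_iff]
      · rw [Fin.cons_succ]
        split_ifs with h
        · simp [Fin.ext_iff]
        · simpa using h)
    (y := Fin.cons x (Fin.cons v t : Fin (m + 1) → V)) (z := Fin.cons x (Function.update t j v))
    (fun i => by
      refine Fin.cases ?_ (fun i => ?_) i
      · simp
      · simp only [Fin.cons_succ]
        split_ifs with h
        · subst h
          rw [Function.update_self, ← Fin.succ_zero_eq_one, Fin.cons_succ, Fin.cons_zero]
        · rw [Function.update_of_ne h, Fin.cons_succ, Fin.cons_succ]) σ₂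
  refine ⟨τ', σ₁', σ₂', (h1' 0).trans h1, (h2' 0).trans h2, ?_⟩
  intro p hp
  simp only [stepPattern, mem_insert, mem_singleton] at hp
  rcases hp with rfl | rfl | rfl
  · rwa [hτ']
  · rwa [hσ₁']
  · rwa [hσ₂']

variable [Fintype V]

open scoped Classical in
theorem sum_card_step_le (G : SatFormula V) (j : Fin m) :
    ∑ x : V, #{p : (Fin m → V) × V | Polar G true x p.1 ∧
      Polar G false x (Function.update p.1 j p.2)} ≤
    (∑ q : (Fin (m + 2) → Bool) × (Fin (m + 2) → Bool) × (Fin (m + 2) → Bool) with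
      q.2.1 0 = true ∧ q.2.2 0 = false, #{y : Fin (m + 2) → V |
        ∀ p ∈ stepPattern j q.1 q.2.1 q.2.2, clauseOn (univ.erase p.1) y p.2 ∈ G}) +
    Fintype.card V * #{z : Fin (m + 1) → V | ¬ Covered G z} := by
  have h1 : ∑ x : V, #{p : (Fin m → V) × V | Polar G true x p.1 ∧
      Polar G false x (Function.update p.1 j p.2)} =
      #{q : V × (Fin m → V) × V | Polar G true q.1 q.2.1 ∧
        Polar G false q.1 (Function.update q.2.1 j q.2.2)} := by
    simp only [card_filter]
    rw [Fintype.sum_prod_type]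
  have h2 : Fintype.card V * #{z : Fin (m + 1) → V | ¬ Covered G z} =
      #{y : Fin (m + 2) → V | ¬ Covered G (Fin.tail y)} := by
    rw [card_filter_fin_cons (fun y : Fin (m + 2) → V => ¬ Covered G (Fin.tail y))]
    simp
  rw [h1, h2]
  refine le_trans ?_ (Nat.add_le_add_right card_biUnion_le _)
  refine le_trans ?_ (card_union_le _ _)
  refine card_le_card_of_injOn
    (fun q => Fin.cons q.1 (Fin.cons q.2.2 q.2.1 : Fin (m + 1) → V)) ?_ ?_
  · rintro ⟨x, t, v⟩ hq
    obtain ⟨hA, hB⟩ := (mem_filter.1 hq).2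
    refine mem_union.2 ?_
    by_cases hC : Covered G (Fin.cons v t : Fin (m + 1) → V)
    · obtain ⟨τ, σ₁, σ₂, h1, h2, h⟩ := exists_stepPattern hA hB hC
      exact Or.inl (mem_biUnion.2 ⟨(τ, σ₁, σ₂), mem_filter.2 ⟨mem_univ _, h1, h2⟩,
        mem_filter.2 ⟨mem_univ _, h⟩⟩)
    · exact Or.inr (mem_filter.2 ⟨mem_univ _, by simpa using hC⟩)
  · rintro ⟨x, t, v⟩ - ⟨x', t', v'⟩ - h
    simp only [Fin.cons_inj] at h
    obtain ⟨rfl, rfl, rfl⟩ := h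
    rfl

open scoped Classical in
theorem exists_dense_stepPattern [Nonempty V] (hm : 0 < m) (hG : IsKFormula (m + 1) G)
    (hS : SimpleFormula G) {ρ η : ℝ} (hρ : 0 < ρ) (hη : (2 * m + 1) * η ≤ ρ ^ 2 / 2)
    (hcov : (#{z : Fin (m + 1) → V | ¬ Covered G z} : ℝ) ≤ η * (Fintype.card V : ℝ) ^ (m + 1))
    (hfar : ¬ ∃ D ⊆ G, (#D : ℝ) ≤ ρ * (Fintype.card V : ℝ) ^ (m + 1) ∧ UnateFormula (G \ D)) :
    ∃ (j : Fin m) (τ σ₁ σ₂ : Fin (m + 2) → Bool), σ₁ 0 = true ∧ σ₂ 0 = false ∧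
      ρ ^ 2 / (4 * (m * 8 ^ (m + 2))) * (Fintype.card V : ℝ) ^ (m + 2) ≤
        #{y : Fin (m + 2) → V |
          ∀ p ∈ stepPattern j τ σ₁ σ₂, clauseOn (univ.erase p.1) y p.2 ∈ G} := by
  have hsq := sq_le_sum_polar_mul_polar hG hS (by positivity) hfar
  have hx : ∀ x : V, (_ : ℝ) ≤ _ := fun x =>
    Nat.cast_le (α := ℝ).2 (card_mul_card_le hm (Polar (m := m) G true x) (Polar G false x))
  have hj : ∀ j : Fin m, (_ : ℝ) ≤ _ := fun j => Nat.cast_le (α := ℝ).2 (sum_card_step_le G j)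
  push_cast at hx hj
  have hu : ∑ x : V, (#{t : Fin m → V | ¬ (Polar G true x t ∨ Polar G false x t)} : ℝ) =
      #{z : Fin (m + 1) → V | ¬ Covered G z} := by
    rw [card_filter_fin_cons]
    push_cast
    simp only [covered_cons_iff]
  have hsum := sum_le_sum fun x (_ : x ∈ univ) => hx x
  have hsumj := sum_le_sum fun j (_ : j ∈ univ) => hj j
  simp only [sum_add_distrib, ← sum_mul, ← mul_sum, hu] at hsum
  rw [sum_comm, sum_add_distrib, sum_const, card_univ, Fintype.card_fin, nsmul_eq_mul] at hsumj
  have hn : (0 : ℝ) < Fintype.card V := by exact_mod_cast Fintype.card_pos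
  by_contra! hcon
  have hm' : (0 : ℝ) < m := by exact_mod_cast hm
  have hS' : ∑ j : Fin m, ∑ q : (Fin (m + 2) → Bool) × (Fin (m + 2) → Bool) × (Fin (m + 2) → Bool)
      with q.2.1 0 = true ∧ q.2.2 0 = false, (#{y : Fin (m + 2) → V |
        ∀ p ∈ stepPattern j q.1 q.2.1 q.2.2, clauseOn (univ.erase p.1) y p.2 ∈ G} : ℝ) ≤
      ρ ^ 2 / 4 * (Fintype.card V : ℝ) ^ (m + 2) := by
    set δ := ρ ^ 2 / (4 * ((m : ℝ) * 8 ^ (m + 2))) * (Fintype.card V : ℝ) ^ (m + 2) with hδ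
    have hδ0 : 0 ≤ δ := by positivity
    refine (sum_le_card_nsmul univ _ (8 ^ (m + 2) * δ) fun j _ => ?_).trans (le_of_eq ?_)
    · refine (sum_le_card_nsmul _ _ δ fun q hq => (hcon j _ _ _ (mem_filter.1 hq).2.1
        (mem_filter.1 hq).2.2).le).trans ?_
      rw [nsmul_eq_mul]
      refine mul_le_mul_of_nonneg_right ?_ hδ0
      refine (Nat.cast_le (α := ℝ).2 (card_filter_le _ _)).trans (le_of_eq ?_)
      simp only [card_univ, Fintype.card_prod, Fintype.card_fun, Fintype.card_bool,
        Fintype.card_fin]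
      push_cast
      rw [← mul_pow, ← mul_pow]
      norm_num
    · rw [card_univ, Fintype.card_fin, nsmul_eq_mul, hδ]
      field_simp
  have h := hsumj.trans (add_le_add_left hS' _)
  generalize (Fintype.card V : ℝ) = n at *
  generalize (#{z : Fin (m + 1) → V | ¬ Covered G z} : ℝ) = c at *
  have h1 : n ^ m * (ρ ^ 2 * n ^ (m + 2)) ≤
      n ^ m * (ρ ^ 2 / 4 * n ^ (m + 2) + m * (n * c) + (m + 1) * (n * c)) := by
    have h2 := mul_le_mul_of_nonneg_right h (pow_nonneg hn.le m)
    have h3 : (n ^ m * (ρ ^ 2 * n ^ (m + 2))) = (ρ * n ^ (m + 1)) ^ 2 := by ring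
    have h4 : (m + 1 : ℝ) * (c * n ^ (m + 1)) = n ^ m * ((m + 1) * (n * c)) := by ring
    linarith
  have h2 := le_of_mul_le_mul_left h1 (by positivity)
  have h3 : n * c ≤ η * n ^ (m + 2) :=
    (mul_le_mul_of_nonneg_left hcov hn.le).trans (le_of_eq (by ring))
  have h4 : (2 * m + 1) * (n * c) ≤ ρ ^ 2 / 2 * n ^ (m + 2) :=
    calc (2 * m + 1) * (n * c) ≤ (2 * m + 1) * (η * n ^ (m + 2)) := by gcongr
      _ = (2 * m + 1) * η * n ^ (m + 2) := by ring
      _ ≤ _ := by gcongr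
  have h5 : 0 < ρ ^ 2 * n ^ (m + 2) := by positivity
  linarith

end Pattern

open Finset in
theorem card_not_injective_le {α β : Type*} [Fintype α] [DecidableEq α] [Fintype β] [DecidableEq β]
    [Nonempty β] [DecidablePred fun f : α → β => ¬ Function.Injective f] :
    (#{f : α → β | ¬ Function.Injective f} : ℝ) ≤
      (Fintype.card α : ℝ) ^ 2 / Fintype.card β * (Fintype.card β : ℝ) ^ Fintype.card α := by
  classical
  have hn : (0 : ℝ) < Fintype.card β := by exact_mod_cast Fintype.card_pos
  have h1 : (#{f : α → β | Function.Injective f} : ℝ) + #{f : α → β | ¬ Function.Injective f} =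
      (Fintype.card β : ℝ) ^ Fintype.card α := by
    have := card_filter_add_card_filter_not (s := (univ : Finset (α → β)))
      (fun f => Function.Injective f)
    rw [card_univ, Fintype.card_fun] at this
    exact_mod_cast this
  rw [card_injective] at h1
  have h5 : (Fintype.card β : ℝ) ^ Fintype.card α * Fintype.card β ≤
      (Fintype.card β).descFactorial (Fintype.card α) * Fintype.card β +
        (Fintype.card α : ℝ) ^ 2 * (Fintype.card β : ℝ) ^ Fintype.card α := by
    exact_mod_cast pow_mul_le_descFactorial (Fintype.card β) (Fintype.card α)
  refine le_of_mul_le_mul_right ?_ hn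
  rw [mul_right_comm, div_mul_cancel₀ _ hn.ne']
  rw [← h1] at h5 ⊢
  linarith

open Finset in
open scoped Classical in
theorem exists_many_copies {m n : ℕ} (hn : 1 ≤ n) {G : SatFormula (Fin n)} {δ : ℝ} (hδ : 0 ≤ δ)
    {j : Fin m} {τ σ₁ σ₂ : Fin (m + 2) → Bool} (h1 : σ₁ 0 = true) (h2 : σ₂ 0 = false)
    (hdense : δ * (Fintype.card (Fin n) : ℝ) ^ (m + 2) ≤ #{y : Fin (m + 2) → Fin n |
      ∀ p ∈ stepPattern j τ σ₁ σ₂, clauseOn (univ.erase p.1) y p.2 ∈ G})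
    (hsmall : ((2 * (m + 1 + 1) : ℕ) : ℝ) ^ 2 / n ≤ δ ^ 2 ^ (m + 2) / 2) :
    ∃ B : SatFormula (Fin (2 * (m + 1 + 1))), IsKFormula (m + 1) B ∧ SimpleFormula B ∧
      ¬ MinimalFormula B ∧
      δ ^ 2 ^ (m + 2) / 2 / ((2 * (m + 1 + 1) : ℕ) : ℝ) ^ (2 * (m + 1 + 1)) *
        n ^ (formulaVars B).card ≤ (copyCount B G : ℝ) := by
  have : Nonempty (Fin n) := ⟨⟨0, hn⟩⟩
  have hblow : δ ^ 2 ^ (m + 2) * (Fintype.card (Fin n) : ℝ) ^ (2 * (m + 1 + 1)) ≤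
      #{φ : Fin (m + 2) → Bool → Fin n | ∀ s : Fin (m + 2) → Bool,
        ∀ p ∈ stepPattern j τ σ₁ σ₂,
          clauseOn (univ.erase p.1) (fun i => φ i (s i)) p.2 ∈ G} := by
    refine (blowup_density (m + 2) (fun y : Fin (m + 2) → Fin n =>
      ∀ p ∈ stepPattern j τ σ₁ σ₂, clauseOn (univ.erase p.1) y p.2 ∈ G) δ hδ
      (hdense.trans (le_of_eq ?_))).trans (le_of_eq ?_)
    · congr!
    · congr!
  have hK : Fintype.card (Fin (m + 2) × Bool) = 2 * (m + 1 + 1) := by simp; ring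
  rw [Fintype.card_fin] at hblow
  generalize δ ^ 2 ^ (m + 2) = δ' at *
  generalize hKdef : 2 * (m + 1 + 1) = K at *
  let e : Fin (m + 2) × Bool ≃ Fin K := Fintype.equivFinOfCardEq hK
  let T := stepPattern j τ σ₁ σ₂
  have hT0 : (0, τ) ∈ T := by simp [T, stepPattern]
  have hT1 : (1, σ₁) ∈ T := by simp [T, stepPattern]
  have hT2 : (j.succ.succ, σ₂) ∈ T := by simp [T, stepPattern]
  have h02 : (0 : Fin (m + 2)) ≠ j.succ.succ := (Fin.succ_ne_zero _).symm
  have h12 : (1 : Fin (m + 2)) ≠ j.succ.succ := by simp [Fin.ext_iff]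
  have hvars : formulaVars (patternBlowup e T) = univ :=
    formulaVars_patternBlowup hT0 hT1 (by simp)
  refine ⟨patternBlowup e T, isKFormula_patternBlowup (by simp),
    simpleFormula_patternBlowup ?_,
    not_minimalFormula_patternBlowup (by simp) h02 h1 h2 hT0 hT1 hT2, ?_⟩
  · intro p hp q hq hpq
    simp only [T, stepPattern, mem_insert, mem_singleton] at hp hq
    rcases hp with rfl | rfl | rfl <;> rcases hq with rfl | rfl | rfl <;>
      first
      | rfl
      | exact absurd hpq (by simp [Fin.ext_iff])
  · have : Nonempty (Fin K) := ⟨e (0, true)⟩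
    have hle := Nat.cast_le (α := ℝ).2 (card_blowups_le hvars G)
    have hinj := card_not_injective_le (α := Fin K) (β := Fin n)
    rw [hvars, card_univ]
    push_cast at hle
    simp only [Fintype.card_fin] at hle hinj hblow ⊢
    have hblow' : δ' * (n : ℝ) ^ K ≤ (K : ℝ) ^ K * (copyCount (patternBlowup e T) G : ℝ) +
        (K : ℝ) ^ 2 / n * (n : ℝ) ^ K := by
      refine le_trans ?_ (hle.trans (by gcongr))
      exact hblow.trans (le_of_eq (by congr!))
    have h3 : (K : ℝ) ^ 2 / n * (n : ℝ) ^ K ≤ δ' / 2 * (n : ℝ) ^ K := by gcongr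
    have hKpos : (0 : ℝ) < (K : ℝ) ^ K := by
      have : 0 < K := by omega
      positivity
    rw [div_mul_eq_mul_div, div_le_iff₀ hKpos]
    linarith

/-- Fix `k ≥ 2`. For every `ρ > 0` there exist `ε > 0`, `c > 0`, `n₀` such
that for all `n ≥ n₀`: every simple `k`-SAT formula on `n` variables with at least
`(1−ε)·C(n,k)` clauses that is `ρ`-far from unate contains at least `c·n^{v(B)}` copies of
some simple non-minimal `k`-SAT formula `B` on at most `2(k+1)` variables. -/
theorem far_from_unate_many_nonminimal (k : ℕ) (hk : 2 ≤ k) (ρ : ℝ) (hρ : 0 < ρ) :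
    ∃ ε : ℝ, 0 < ε ∧ ∃ c : ℝ, 0 < c ∧ ∃ n₀ : ℕ, ∀ n ≥ n₀,
      ∀ G : SatFormula (Fin n), IsKFormula k G → SimpleFormula G →
      (1 - ε) * (n.choose k : ℝ) ≤ G.card →
      (¬ ∃ D ⊆ G, (D.card : ℝ) ≤ ρ * n ^ k ∧ UnateFormula (G \ D)) →
      ∃ B : SatFormula (Fin (2 * (k + 1))), IsKFormula k B ∧ SimpleFormula B ∧
        ¬ MinimalFormula B ∧
        c * n ^ (formulaVars B).card ≤ (copyCount B G : ℝ) := by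
  classical
  obtain ⟨m, rfl⟩ : ∃ m, k = m + 1 := ⟨k - 1, by omega⟩
  have hm : 0 < m := by omega
  set K : ℕ := 2 * (m + 1 + 1) with hK
  let η : ℝ := ρ ^ 2 / (4 * (m + 1))
  have hη : 0 < η := by positivity
  let δ : ℝ := ρ ^ 2 / (4 * (m * 8 ^ (m + 2)))
  have hδ : 0 < δ := by positivity
  let δ' : ℝ := δ ^ 2 ^ (m + 2)
  have hδ' : 0 < δ' := by positivity
  obtain ⟨n₁, hn₁⟩ := exists_nat_ge ((((m + 1 : ℕ) : ℝ) ^ 2) / (η / 2))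
  obtain ⟨n₂, hn₂⟩ := exists_nat_ge ((K : ℝ) ^ 2 / (δ' / 2))
  refine ⟨η / 2, by positivity, δ' / 2 / (K : ℝ) ^ K, by positivity, max 1 (max n₁ n₂), ?_⟩
  intro n hn G hG hS hcard hfar
  simp only [ge_iff_le, max_le_iff] at hn
  obtain ⟨hn0, hn1, hn2⟩ := hn
  have hnpos : (0 : ℝ) < n := by exact_mod_cast hn0
  have : Nonempty (Fin n) := ⟨⟨0, hn0⟩⟩
  have hsmall₁ : (((m + 1 : ℕ) : ℝ) ^ 2) / n ≤ η / 2 := by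
    rw [div_le_iff₀ hnpos, mul_comm, ← div_le_iff₀ (by positivity)]
    exact hn₁.trans (by exact_mod_cast hn1)
  have hsmall₂ : (K : ℝ) ^ 2 / n ≤ δ' / 2 := by
    rw [div_le_iff₀ hnpos, mul_comm, ← div_le_iff₀ (by positivity)]
    exact hn₂.trans (by exact_mod_cast hn2)
  have hcov : (Finset.card {z : Fin (m + 1) → Fin n | ¬ Covered G z} : ℝ) ≤
      η * (Fintype.card (Fin n) : ℝ) ^ (m + 1) := by
    refine (card_not_covered_le hG hS (by positivity : 0 ≤ η / 2)
      (by simpa using hcard)).trans ?_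
    rw [Fintype.card_fin]
    gcongr
    linarith
  obtain ⟨j, τ, σ₁, σ₂, h1, h2, hdense⟩ := exists_dense_stepPattern hm hG hS hρ
    (by
      simp only [η]
      rw [mul_div_assoc', div_le_div_iff₀ (by positivity) (by positivity)]
      nlinarith [sq_nonneg ρ])
    hcov (by simpa using hfar)
  exact exists_many_copies hn0 hδ.le h1 h2 hdense hsmall₂
end
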